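/- arXiv:2001.02528 — 5 statements merged into one kernel-verified Lean document; each statement's English description precedes it below -/
import Mathlib

section
/- Let (b,Q,ν) be a Lévy triplet on ℝ^d with characteristic exponent ψ, and let A and A* be the associated Lévy generator and its adjoint. Assume that for every t > 0 there exists a bounded continuous function p_t : ℝ^d → [0,∞) with ∫_{ℝ^d} p_t(x) dx = 1 and ∫_{ℝ^d} e^{i ξ·x} p_t(x) dx = e^{−t ψ(ξ)} for all ξ ∈ ℝ^d. If u : ℝ^d → ℝ is bounded and measurable and ∫_{ℝ^d} u(x) A*φ(x) dx = 0 for all φ ∈ C_c^∞(ℝ^d), then u is constant Lebesgue-almost everywhere (Liouville property). -/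
open MeasureTheory Real Filter Metric
open scoped ENNReal RealInnerProductSpace Topology

noncomputable section

/-- `ℝ^d` as a Euclidean space. -/
abbrev Ed (d : ℕ) := EuclideanSpace ℝ (Fin d)

/-- Indicator function `1_{(0,1)}(‖y‖)`. -/
def smallCut {d : ℕ} (y : Ed d) : ℝ := if 0 < ‖y‖ ∧ ‖y‖ < 1 then 1 else 0

/-- The Lévy generator associated with the triplet `(b, Q, ν)`:
`Af(x) = b·∇f(x) + (1/2) tr(Q ∇²f(x)) + ∫ (f(x+y) - f(x) - y·∇f(x) 1_{(0,1)}(|y|)) ν(dy)`. -/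
noncomputable def levyGen {d : ℕ} (b : Ed d) (Q : Matrix (Fin d) (Fin d) ℝ)
    (ν : Measure (Ed d)) (f : Ed d → ℝ) (x : Ed d) : ℝ :=
  ⟪b, gradient f x⟫
    + (1 / 2) * ∑ i, ∑ j, Q i j *
        fderiv ℝ (fun z => fderiv ℝ f z (EuclideanSpace.single j 1)) x (EuclideanSpace.single i 1)
    + ∫ y, (f (x + y) - f x - smallCut y * ⟪y, gradient f x⟫) ∂ν

/-- The characteristic exponent associated with the triplet `(b, Q, ν)`:
`ψ(ξ) = i b·ξ + (1/2) ξ·Qξ + ∫ (1 - e^{iy·ξ} + iy·ξ 1_{(0,1)}(|y|)) ν(dy)`. -/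
noncomputable def charExp {d : ℕ} (b : Ed d) (Q : Matrix (Fin d) (Fin d) ℝ)
    (ν : Measure (Ed d)) (ξ : Ed d) : ℂ :=
  Complex.I * ((⟪b, ξ⟫ : ℝ) : ℂ)
    + (1 / 2) * ((∑ i, ∑ j, ξ i * Q i j * ξ j : ℝ) : ℂ)
    + ∫ y, (1 - Complex.exp (Complex.I * ((⟪y, ξ⟫ : ℝ) : ℂ))
        + Complex.I * ((⟪y, ξ⟫ : ℝ) : ℂ) * (smallCut y : ℂ)) ∂ν

/-- `(b, Q, ν)` is a Lévy triplet on `ℝ^d`: `Q` is symmetric positive semidefinite,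
`ν({0}) = 0` and `∫ min(1,|y|²) ν(dy) < ∞`. -/
structure IsLevyTriplet {d : ℕ} (b : Ed d) (Q : Matrix (Fin d) (Fin d) ℝ)
    (ν : Measure (Ed d)) : Prop where
  posSemidef : Q.PosSemidef
  nuZero : ν {0} = 0
  nuFin : ∫⁻ y, ENNReal.ofReal (min 1 (‖y‖ ^ 2)) ∂ν ≠ ⊤

/-- `p` is a probability density whose Fourier transform is `e^{-t ψ}`, where `ψ` is the
characteristic exponent of the Lévy triplet `(b, Q, ν)`. -/
def IsTransDensity {d : ℕ} (b : Ed d) (Q : Matrix (Fin d) (Fin d) ℝ) (ν : Measure (Ed d))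
    (t : ℝ) (p : Ed d → ℝ) : Prop :=
  (∀ x, 0 ≤ p x) ∧ (∫ x, p x) = 1 ∧
    ∀ ξ : Ed d, (∫ x, Complex.exp (Complex.I * ((⟪ξ, x⟫ : ℝ) : ℂ)) * (p x : ℂ))
      = Complex.exp (-(t : ℂ) * charExp b Q ν ξ)

/-- `u` is a weak solution of `A u = 0` on `ℝ^d`, tested against the adjoint generator `A*`,
i.e. the Lévy generator with triplet `(-b, Q, ν ∘ (y ↦ -y))`. -/
def IsWeakSolZero {d : ℕ} (b : Ed d) (Q : Matrix (Fin d) (Fin d) ℝ) (ν : Measure (Ed d))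
    (u : Ed d → ℝ) : Prop :=
  ∀ φ : Ed d → ℝ, ContDiff ℝ (⊤ : ℕ∞) φ → HasCompactSupport φ →
    ∫ x, u x * levyGen (-b) Q (Measure.map Neg.neg ν) φ x = 0

/-- The plane wave `x ↦ exp(2πi⟨w, x⟩)`. -/
def wave {d : ℕ} (w x : Ed d) : ℂ := Complex.exp (↑(2 * π * ⟪w, x⟫) * Complex.I)

/-- The compensated plane wave which is integrated against the Lévy measure in the symbol. -/
def waveKernel {d : ℕ} (w y : Ed d) : ℂ :=
  wave w y - 1 - (smallCut y : ℂ) * (2 * π * Complex.I * ((⟪w, y⟫ : ℝ) : ℂ))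

/-- The Fourier symbol of the Lévy generator: `levyGen` multiplies `wave w` by `levySymbol w`. -/
def levySymbol {d : ℕ} (b : Ed d) (Q : Matrix (Fin d) (Fin d) ℝ) (ν : Measure (Ed d))
    (w : Ed d) : ℂ :=
  2 * π * Complex.I * ((⟪w, b⟫ : ℝ) : ℂ)
    + (1 / 2) * ∑ i, ∑ j, (Q i j : ℂ) *
      ((2 * π * Complex.I * (w i : ℂ)) * (2 * π * Complex.I * (w j : ℂ)))
    + ∫ y, waveKernel w y ∂ν

section Basic

variable {d : ℕ}

lemma norm_wave (w x : Ed d) : ‖wave w x‖ = 1 := Complex.norm_exp_ofReal_mul_I _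

lemma wave_add (w x y : Ed d) : wave w (x + y) = wave w x * wave w y := by
  rw [wave, wave, wave, ← Complex.exp_add, inner_add_right]
  congr 1
  push_cast
  ring

lemma wave_sub (w x y : Ed d) : wave w (x - y) = wave w x * wave w (-y) := by
  rw [sub_eq_add_neg, wave_add]

lemma continuous_wave : Continuous fun z : Ed d × Ed d => wave z.1 z.2 := by
  unfold wave
  fun_prop

lemma measurable_smallCut : Measurable (smallCut : Ed d → ℝ) := by
  unfold smallCut
  refine Measurable.ite ?_ measurable_const measurable_const
  exact (measurableSet_lt measurable_const measurable_norm).inter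
    (measurableSet_lt measurable_norm measurable_const)

lemma smallCut_of_one_le {y : Ed d} (h : 1 ≤ ‖y‖) : smallCut y = 0 := by
  simp [smallCut, not_lt.2 h]

lemma smallCut_of_lt_one {y : Ed d} (h0 : y ≠ 0) (h : ‖y‖ < 1) : smallCut y = 1 := by
  simp [smallCut, h0, h]

lemma measurable_waveKernel : Measurable fun z : Ed d × Ed d => waveKernel z.1 z.2 := by
  unfold waveKernel
  have h1 := (continuous_wave (d := d)).measurable
  have h2 : Measurable fun z : Ed d × Ed d => (smallCut z.2 : ℂ) :=
    Complex.measurable_ofReal.comp (measurable_smallCut.comp measurable_snd)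
  have h3 : Measurable fun z : Ed d × Ed d => 2 * π * Complex.I * ((⟪z.1, z.2⟫ : ℝ) : ℂ) := by
    apply Continuous.measurable
    fun_prop
  exact (h1.sub measurable_const).sub (h2.mul h3)

lemma norm_waveKernel_le (w y : Ed d) :
    ‖waveKernel w y‖ ≤ (12 * π ^ 2 + 2) * (1 + ‖w‖ ^ 2) * min 1 (‖y‖ ^ 2) := by
  have hpi := sq_nonneg π
  have hw := sq_nonneg ‖w‖
  by_cases hy0 : y = 0
  · simp [hy0, waveKernel, wave, smallCut]
  rcases le_or_gt 1 ‖y‖ with hy | hy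
  · have : min 1 (‖y‖ ^ 2) = 1 := min_eq_left (one_le_pow₀ hy)
    rw [this, waveKernel, smallCut_of_one_le hy]
    have h2 : ‖wave w y - 1‖ ≤ 2 := by
      refine (norm_sub_le _ _).trans ?_
      rw [norm_wave, norm_one]
      norm_num
    simp only [Complex.ofReal_zero, zero_mul, sub_zero, mul_one]
    nlinarith
  · have : min 1 (‖y‖ ^ 2) = ‖y‖ ^ 2 := min_eq_right (pow_le_one₀ (norm_nonneg _) hy.le)
    rw [this, waveKernel, smallCut_of_lt_one hy0 hy, wave]
    set θ : ℝ := 2 * π * ⟪w, y⟫ with hθ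
    have e : (((1 : ℝ) : ℂ)) * (2 * π * Complex.I * ((⟪w, y⟫ : ℝ) : ℂ)) = θ * Complex.I := by
      rw [hθ]; push_cast; ring
    rw [e]
    have hn : ‖(θ : ℂ) * Complex.I‖ = |θ| := by simp
    have key : ‖Complex.exp (θ * Complex.I) - 1 - θ * Complex.I‖ ≤ 3 * θ ^ 2 := by
      rcases le_or_gt |θ| 1 with h | h
      · have := Complex.norm_exp_sub_one_sub_id_le (x := θ * Complex.I) (by rwa [hn])
        rw [hn, sq_abs] at this
        nlinarith [sq_nonneg θ]
      · refine (norm_sub_le _ _).trans ?_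
        have : ‖Complex.exp (θ * Complex.I) - 1‖ ≤ 2 := by
          refine (norm_sub_le _ _).trans ?_
          rw [Complex.norm_exp_ofReal_mul_I, norm_one]
          norm_num
        rw [hn, ← sq_abs]
        nlinarith
    have hc : |⟪w, y⟫| ≤ ‖w‖ * ‖y‖ := abs_real_inner_le_norm w y
    have hc2 : ⟪w, y⟫ ^ 2 ≤ ‖w‖ ^ 2 * ‖y‖ ^ 2 := by
      rw [← mul_pow, ← sq_abs]
      exact pow_le_pow_left₀ (abs_nonneg _) hc 2
    have : 3 * θ ^ 2 ≤ 12 * π ^ 2 * (‖w‖ ^ 2 * ‖y‖ ^ 2) := by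
      rw [hθ]
      nlinarith [mul_le_mul_of_nonneg_left hc2 hpi]
    refine key.trans (this.trans ?_)
    have hy2 := sq_nonneg ‖y‖
    nlinarith [mul_nonneg hw hy2, mul_nonneg hpi hy2]

lemma integrable_min_one_sq {ν : Measure (Ed d)}
    (h : ∫⁻ y, ENNReal.ofReal (min 1 (‖y‖ ^ 2)) ∂ν ≠ ⊤) :
    Integrable (fun y => min 1 (‖y‖ ^ 2)) ν := by
  refine ⟨Continuous.aestronglyMeasurable (by fun_prop), ?_⟩
  rw [hasFiniteIntegral_iff_ofReal (ae_of_all _ fun y => by positivity)]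
  exact lt_top_iff_ne_top.2 h

lemma sigmaFinite_of_integrable_min {ν : Measure (Ed d)} (h0 : ν {0} = 0)
    (h : Integrable (fun y => min 1 (‖y‖ ^ 2)) ν) : SigmaFinite ν := by
  let S : ℕ → Set (Ed d) := fun n => {y | (1 / ((n : ℝ) + 1)) ≤ min 1 (‖y‖ ^ 2)}
  refine Measure.sigmaFinite_of_countable (S := insert {0} (Set.range S))
    ((Set.countable_range S).insert _) ?_ ?_
  · rintro s (rfl | ⟨n, rfl⟩)
    · simp [h0]
    · exact h.measure_ge_lt_top (by positivity)
  · refine Set.eq_univ_of_forall fun y => ?_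
    by_cases hy : y = 0
    · exact ⟨{0}, Set.mem_insert _ _, hy⟩
    · have hp : 0 < min 1 (‖y‖ ^ 2) := lt_min one_pos (by positivity)
      obtain ⟨n, hn⟩ := exists_nat_one_div_lt hp
      exact ⟨S n, Set.mem_insert_of_mem _ ⟨n, rfl⟩, hn.le⟩

/-- Fourier inversion for a test function and its derivatives. -/
lemma exists_fourier_repr {φ : Ed d → ℝ} (hφ : ContDiff ℝ (⊤ : ℕ∞) φ)
    (hc : HasCompactSupport φ) :
    ∃ G : Ed d → ℂ, Continuous G ∧ Integrable (fun w => (1 + ‖w‖ ^ 2) * ‖G w‖) ∧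
      (∀ x, (φ x : ℂ) = ∫ w, G w * wave w x) ∧
      (∀ x m, (fderiv ℝ φ x m : ℂ) =
        ∫ w, G w * (2 * π * Complex.I * ((⟪w, m⟫ : ℝ) : ℂ)) * wave w x) ∧
      (∀ x m n, (fderiv ℝ (fun z => fderiv ℝ φ z m) x n : ℂ) =
        ∫ w, G w * ((2 * π * Complex.I * ((⟪w, n⟫ : ℝ) : ℂ)) *
          (2 * π * Complex.I * ((⟪w, m⟫ : ℝ) : ℂ))) * wave w x) := by
  have hc' : HasCompactSupport fun x => (φ x : ℂ) :=
    hc.comp_left (g := fun r : ℝ => (r : ℂ)) Complex.ofReal_zero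
  have hφ' : ContDiff ℝ (⊤ : ℕ∞) fun x => (φ x : ℂ) := Complex.ofRealCLM.contDiff.comp hφ
  let f : SchwartzMap (Ed d) ℂ := hc'.toSchwartzMap hφ'
  have hf : ∀ x, f x = φ x := fun x => rfl
  have inv : ∀ (g : SchwartzMap (Ed d) ℂ) (x : Ed d),
      g x = ∫ w, FourierTransform.fourier g w * wave w x := by
    intro g x
    conv_lhs => rw [← FourierPair.fourierInv_fourier_eq (F := SchwartzMap (Ed d) ℂ) g]
    rw [SchwartzMap.fourierInv_coe, Real.fourierInv_eq']
    refine integral_congr_ae (ae_of_all _ fun w => ?_)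
    simp [wave, mul_comm]
  have hder : ∀ (g : SchwartzMap (Ed d) ℂ) (m w : Ed d),
      FourierTransform.fourier (LineDeriv.lineDerivOp m g) w =
        2 * π * Complex.I * ((⟪w, m⟫ : ℝ) : ℂ) * FourierTransform.fourier g w := by
    intro g m w
    have : (inner ℝ · m : Ed d → ℝ).HasTemperateGrowth :=
      ((innerSL ℝ).flip m).hasTemperateGrowth
    rw [SchwartzMap.fourier_lineDerivOp_eq]
    simp [this, mul_assoc]
  have d1 : ∀ m x, (LineDeriv.lineDerivOp m f) x = (fderiv ℝ φ x m : ℂ) := by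
    intro m x
    rw [SchwartzMap.lineDerivOp_apply_eq_fderiv]
    have h1 : HasFDerivAt φ (fderiv ℝ φ x) x :=
      (hφ.differentiable (by simp)).differentiableAt.hasFDerivAt
    have h2 : HasFDerivAt (f : Ed d → ℂ) (Complex.ofRealCLM.comp (fderiv ℝ φ x)) x :=
      Complex.ofRealCLM.hasFDerivAt.comp x h1
    rw [h2.fderiv]
    rfl
  have d2 : ∀ m n x, (LineDeriv.lineDerivOp n (LineDeriv.lineDerivOp m f)) x =
      (fderiv ℝ (fun z => fderiv ℝ φ z m) x n : ℂ) := by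
    intro m n x
    rw [SchwartzMap.lineDerivOp_apply_eq_fderiv]
    have hs : ContDiff ℝ (⊤ : ℕ∞) fun z => fderiv ℝ φ z m :=
      (hφ.fderiv_right (m := (⊤ : ℕ∞)) (by simp)).clm_apply contDiff_const
    have h1 : HasFDerivAt (fun z => fderiv ℝ φ z m) (fderiv ℝ (fun z => fderiv ℝ φ z m) x) x :=
      (hs.differentiable (by simp)).differentiableAt.hasFDerivAt
    have h2 : HasFDerivAt (LineDeriv.lineDerivOp m f : Ed d → ℂ)
        (Complex.ofRealCLM.comp (fderiv ℝ (fun z => fderiv ℝ φ z m) x)) x := by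
      have := Complex.ofRealCLM.hasFDerivAt.comp x h1
      refine this.congr_of_eventuallyEq (Filter.Eventually.of_forall fun z => ?_)
      exact d1 m z
    rw [h2.fderiv]
    rfl
  refine ⟨FourierTransform.fourier f, SchwartzMap.continuous _, ?_, fun x => ?_,
    fun x m => ?_, fun x m n => ?_⟩
  · have h0 := (FourierTransform.fourier f).integrable_pow_mul volume 0
    have h2 := (FourierTransform.fourier f).integrable_pow_mul volume 2
    refine (h0.add h2).congr (ae_of_all _ fun w => ?_)
    simp only [Pi.add_apply]
    ring
  · rw [← hf, inv f x]
  · rw [← d1, inv]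
    refine integral_congr_ae (ae_of_all _ fun w => ?_)
    simp only [hder]
    ring
  · rw [← d2, inv]
    refine integral_congr_ae (ae_of_all _ fun w => ?_)
    simp only [hder]
    ring

end Basic

section Generator

variable {d : ℕ}

lemma inner_gradient_eq_fderiv (f : Ed d → ℝ) (x y : Ed d) :
    ⟪y, gradient f x⟫ = fderiv ℝ f x y := by
  rw [real_inner_comm, ← toDual_gradient (𝕜 := ℝ) (f := f), InnerProductSpace.toDual_apply_apply]

lemma integrable_mul_of_norm_le {G : Ed d → ℂ} (hG : Continuous G)
    (hi : Integrable fun w => (1 + ‖w‖ ^ 2) * ‖G w‖) {h : Ed d → ℂ} (hm : Measurable h)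
    {C : ℝ} (hb : ∀ w, ‖h w‖ ≤ C * (1 + ‖w‖ ^ 2)) : Integrable fun w => G w * h w := by
  refine (hi.const_mul C).mono' (hG.aestronglyMeasurable.mul hm.aestronglyMeasurable)
    (ae_of_all _ fun w => ?_)
  rw [norm_mul]
  nlinarith [mul_le_mul_of_nonneg_left (hb w) (norm_nonneg (G w))]

lemma norm_freq_le (w m : Ed d) :
    ‖2 * π * Complex.I * ((⟪w, m⟫ : ℝ) : ℂ)‖ ≤ (2 * π * ‖m‖) * ‖w‖ := by
  have : ‖2 * (π : ℂ) * Complex.I * ((⟪w, m⟫ : ℝ) : ℂ)‖ = 2 * π * |⟪w, m⟫| := by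
    simp [abs_of_pos pi_pos]
  rw [this]
  nlinarith [mul_le_mul_of_nonneg_left (abs_real_inner_le_norm w m) (two_pi_pos.le)]

lemma norm_mul_wave (z : ℂ) (w x : Ed d) : ‖z * wave w x‖ = ‖z‖ := by
  rw [norm_mul, norm_wave, mul_one]

lemma measurable_wave_left (x : Ed d) : Measurable fun w : Ed d => wave w x :=
  (continuous_wave.comp (by fun_prop : Continuous fun w : Ed d => (w, x))).measurable

lemma measurable_freq (m : Ed d) :
    Measurable fun w : Ed d => 2 * π * Complex.I * ((⟪w, m⟫ : ℝ) : ℂ) :=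
  Continuous.measurable (by fun_prop)

lemma measurable_levySymbol (b : Ed d) (Q : Matrix (Fin d) (Fin d) ℝ) (ν : Measure (Ed d))
    [SFinite ν] : Measurable (levySymbol b Q ν) := by
  unfold levySymbol
  refine Measurable.add (Continuous.measurable (by fun_prop)) ?_
  exact (measurable_waveKernel.stronglyMeasurable.integral_prod_right (ν := ν)).measurable

lemma norm_integral_waveKernel_le {ν : Measure (Ed d)}
    (hν : Integrable (fun y => min 1 (‖y‖ ^ 2)) ν) (w : Ed d) :
    ‖∫ y, waveKernel w y ∂ν‖ ≤
      ((12 * π ^ 2 + 2) * ∫ y, min 1 (‖y‖ ^ 2) ∂ν) * (1 + ‖w‖ ^ 2) := by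
  refine (norm_integral_le_of_norm_le (hν.const_mul ((12 * π ^ 2 + 2) * (1 + ‖w‖ ^ 2)))
    (ae_of_all _ fun y => norm_waveKernel_le w y)).trans ?_
  rw [integral_const_mul]
  apply le_of_eq
  ring

lemma norm_sq_freq_le (w m n : Ed d) :
    ‖(2 * π * Complex.I * ((⟪w, n⟫ : ℝ) : ℂ)) * (2 * π * Complex.I * ((⟪w, m⟫ : ℝ) : ℂ))‖
      ≤ (2 * π * ‖n‖) * (2 * π * ‖m‖) * (1 + ‖w‖ ^ 2) := by
  rw [norm_mul]
  refine (mul_le_mul (norm_freq_le w n) (norm_freq_le w m) (norm_nonneg _)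
    (by positivity)).trans ?_
  have : 0 ≤ (2 * π * ‖n‖) * (2 * π * ‖m‖) := by positivity
  nlinarith

lemma norm_freq_le_one_add_sq (w m : Ed d) :
    ‖2 * π * Complex.I * ((⟪w, m⟫ : ℝ) : ℂ)‖ ≤ (2 * π * ‖m‖) * (1 + ‖w‖ ^ 2) := by
  refine (norm_freq_le w m).trans (mul_le_mul_of_nonneg_left ?_ (by positivity))
  nlinarith [sq_nonneg (‖w‖ - 1)]

/-- The symbol of a Lévy generator grows at most quadratically. -/
lemma exists_norm_levySymbol_le (b : Ed d) (Q : Matrix (Fin d) (Fin d) ℝ) {ν : Measure (Ed d)}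
    (hν : Integrable (fun y => min 1 (‖y‖ ^ 2)) ν) :
    ∃ C, ∀ w, ‖levySymbol b Q ν w‖ ≤ C * (1 + ‖w‖ ^ 2) := by
  refine ⟨2 * π * ‖b‖ + (1 / 2) * (∑ i, ∑ j, |Q i j| * ((2 * π) * (2 * π))) +
    (12 * π ^ 2 + 2) * ∫ y, min 1 (‖y‖ ^ 2) ∂ν, fun w => ?_⟩
  rw [levySymbol, add_mul, add_mul]
  refine norm_add₃_le.trans (add_le_add_three (norm_freq_le_one_add_sq w b) ?_
    (norm_integral_waveKernel_le hν w))
  rw [norm_mul, mul_assoc (1 / 2 : ℝ), Finset.sum_mul]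
  have : ‖(1 / 2 : ℂ)‖ = 1 / 2 := by simp
  rw [this]
  refine mul_le_mul_of_nonneg_left ?_ (by norm_num)
  refine (norm_sum_le _ _).trans (Finset.sum_le_sum fun i _ => ?_)
  rw [Finset.sum_mul]
  refine (norm_sum_le _ _).trans (Finset.sum_le_sum fun j _ => ?_)
  rw [norm_mul, mul_assoc |Q i j|, Complex.norm_real, Real.norm_eq_abs]
  refine mul_le_mul_of_nonneg_left ?_ (abs_nonneg _)
  have := norm_sq_freq_le w (EuclideanSpace.single j (1 : ℝ)) (EuclideanSpace.single i (1 : ℝ))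
  simpa [EuclideanSpace.inner_single_right] using this

lemma integral_freq_eq_increment {φ : Ed d → ℝ} {G : Ed d → ℂ} (hG : Continuous G)
    (hi : Integrable fun w => (1 + ‖w‖ ^ 2) * ‖G w‖)
    (h0 : ∀ x, (φ x : ℂ) = ∫ w, G w * wave w x)
    (h1 : ∀ x m, (fderiv ℝ φ x m : ℂ) =
        ∫ w, G w * (2 * π * Complex.I * ((⟪w, m⟫ : ℝ) : ℂ)) * wave w x) (x y : Ed d) :
    ((φ (x + y) - φ x - smallCut y * fderiv ℝ φ x y : ℝ) : ℂ) =
      ∫ w, G w * (waveKernel w y * wave w x) := by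
  have i0 : ∀ z, Integrable fun w => G w * wave w z := fun z =>
    integrable_mul_of_norm_le hG hi (C := 1) (measurable_wave_left z) fun w => by
      rw [norm_wave]; nlinarith [sq_nonneg ‖w‖]
  have i1 : Integrable fun w => G w * (2 * π * Complex.I * ((⟪w, y⟫ : ℝ) : ℂ)) * wave w x := by
    simp_rw [mul_assoc (G _)]
    refine integrable_mul_of_norm_le hG hi (C := 2 * π * ‖y‖)
      ((measurable_freq y).mul (measurable_wave_left x)) fun w => ?_
    rw [norm_mul_wave]
    exact norm_freq_le_one_add_sq w y
  have i01 : Integrable fun w => G w * wave w (x + y) - G w * wave w x := (i0 _).sub (i0 _)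
  push_cast
  rw [h0, h0, h1, ← integral_const_mul, ← integral_sub (i0 _) (i0 _),
    ← integral_sub i01 (i1.const_mul _)]
  refine integral_congr_ae (ae_of_all _ fun w => ?_)
  simp only [waveKernel, wave_add]
  ring

lemma integrable_waveKernel_prod {G : Ed d → ℂ} (hG : Continuous G)
    (hi : Integrable fun w => (1 + ‖w‖ ^ 2) * ‖G w‖) {ν : Measure (Ed d)} [SFinite ν]
    (hν : Integrable (fun y => min 1 (‖y‖ ^ 2)) ν) (x : Ed d) :
    Integrable (fun z : Ed d × Ed d => G z.2 * (waveKernel z.2 z.1 * wave z.2 x))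
      (ν.prod volume) := by
  have hp := hν.mul_prod (hi.const_mul (12 * π ^ 2 + 2))
  refine hp.mono' ?_ (ae_of_all _ fun z => ?_)
  · refine Measurable.aestronglyMeasurable ?_
    exact (hG.measurable.comp measurable_snd).mul
      ((measurable_waveKernel.comp measurable_swap).mul
        ((measurable_wave_left x).comp measurable_snd))
  · rw [norm_mul, norm_mul_wave]
    have := mul_le_mul_of_nonneg_left (norm_waveKernel_le z.2 z.1) (norm_nonneg (G z.2))
    refine this.trans (le_of_eq ?_)
    ring

/-- The Lévy generator acts on test functions as a Fourier multiplier. -/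
lemma levyGen_eq_integral (b : Ed d) (Q : Matrix (Fin d) (Fin d) ℝ) {ν : Measure (Ed d)}
    [SFinite ν] (hν : Integrable (fun y => min 1 (‖y‖ ^ 2)) ν) {φ : Ed d → ℝ} {G : Ed d → ℂ}
    (hG : Continuous G) (hi : Integrable fun w => (1 + ‖w‖ ^ 2) * ‖G w‖)
    (h0 : ∀ x, (φ x : ℂ) = ∫ w, G w * wave w x)
    (h1 : ∀ x m, (fderiv ℝ φ x m : ℂ) =
        ∫ w, G w * (2 * π * Complex.I * ((⟪w, m⟫ : ℝ) : ℂ)) * wave w x)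
    (h2 : ∀ x m n, (fderiv ℝ (fun z => fderiv ℝ φ z m) x n : ℂ) =
        ∫ w, G w * ((2 * π * Complex.I * ((⟪w, n⟫ : ℝ) : ℂ)) *
          (2 * π * Complex.I * ((⟪w, m⟫ : ℝ) : ℂ))) * wave w x) (x : Ed d) :
    (levyGen b Q ν φ x : ℂ) = ∫ w, G w * levySymbol b Q ν w * wave w x := by
  have ij : ∀ i j : Fin d, Integrable fun w => (Q i j : ℂ) *
      (G w * ((2 * π * Complex.I * (w i : ℂ)) * (2 * π * Complex.I * (w j : ℂ))) * wave w x) := by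
    intro i j
    simp_rw [mul_assoc (G _)]
    refine (integrable_mul_of_norm_le hG hi (C := (2 * π) * (2 * π))
      (Measurable.mul (Continuous.measurable (by fun_prop)) (measurable_wave_left x))
      fun w => ?_).const_mul _
    rw [Pi.mul_apply, norm_mul_wave]
    have := norm_sq_freq_le w (EuclideanSpace.single j (1 : ℝ)) (EuclideanSpace.single i (1 : ℝ))
    simpa [EuclideanSpace.inner_single_right] using this
  have i1 : Integrable fun w => G w * (2 * π * Complex.I * ((⟪w, b⟫ : ℝ) : ℂ)) * wave w x := by
    simp_rw [mul_assoc (G _)]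
    refine integrable_mul_of_norm_le hG hi (C := 2 * π * ‖b‖)
      ((measurable_freq b).mul (measurable_wave_left x)) fun w => ?_
    rw [norm_mul_wave]
    exact norm_freq_le_one_add_sq w b
  have e2 : ∀ i j : Fin d, (fderiv ℝ (fun z => fderiv ℝ φ z (EuclideanSpace.single j 1)) x
      (EuclideanSpace.single i 1) : ℂ) =
        ∫ w, G w * ((2 * π * Complex.I * (w i : ℂ)) * (2 * π * Complex.I * (w j : ℂ))) *
          wave w x := by
    intro i j
    rw [h2]
    simp [EuclideanSpace.inner_single_right]
  have e3 : ((∫ y, (φ (x + y) - φ x - smallCut y * ⟪y, gradient φ x⟫) ∂ν : ℝ) : ℂ) =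
      ∫ w, G w * ((∫ y, waveKernel w y ∂ν) * wave w x) := by
    rw [← integral_complex_ofReal]
    simp_rw [inner_gradient_eq_fderiv, integral_freq_eq_increment hG hi h0 h1]
    rw [integral_integral_swap (integrable_waveKernel_prod hG hi hν x)]
    refine integral_congr_ae (ae_of_all _ fun w => ?_)
    simp only
    rw [integral_const_mul, integral_mul_const]
  have i3 : Integrable fun w => G w * ((∫ y, waveKernel w y ∂ν) * wave w x) := by
    refine integrable_mul_of_norm_le hG hi
      (C := (12 * π ^ 2 + 2) * ∫ y, min 1 (‖y‖ ^ 2) ∂ν)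
      (Measurable.mul ?_ (measurable_wave_left x)) fun w => ?_
    · exact (measurable_waveKernel.stronglyMeasurable.integral_prod_right (ν := ν)).measurable
    · rw [norm_mul_wave]
      exact norm_integral_waveKernel_le hν w
  have i2 : Integrable fun w => (1 / 2 : ℂ) * ∑ i, ∑ j, (Q i j : ℂ) *
      (G w * ((2 * π * Complex.I * (w i : ℂ)) * (2 * π * Complex.I * (w j : ℂ))) * wave w x) :=
    (integrable_finsetSum _ fun i _ => integrable_finsetSum _ fun j _ => ij i j).const_mul _
  have i12 := i1.add i2
  simp only [Pi.add_def] at i12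
  rw [levyGen, Complex.ofReal_add, Complex.ofReal_add, e3, inner_gradient_eq_fderiv, h1]
  push_cast
  simp_rw [e2, ← integral_const_mul]
  rw [show (∑ i, ∑ j, ∫ w, (Q i j : ℂ) *
      (G w * ((2 * π * Complex.I * (w i : ℂ)) * (2 * π * Complex.I * (w j : ℂ))) * wave w x)) =
      ∫ w, ∑ i, ∑ j, (Q i j : ℂ) *
      (G w * ((2 * π * Complex.I * (w i : ℂ)) * (2 * π * Complex.I * (w j : ℂ))) * wave w x) by
    rw [integral_finsetSum _ fun i _ => integrable_finsetSum _ fun j _ => ij i j]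
    refine Finset.sum_congr rfl fun i _ => ?_
    rw [integral_finsetSum _ fun j _ => ij i j]]
  rw [← integral_const_mul, ← integral_add i1 i2, ← integral_add i12 i3]
  refine integral_congr_ae (ae_of_all _ fun w => ?_)
  simp only [levySymbol, mul_add, add_mul, Finset.mul_sum, Finset.sum_mul]
  congr 1
  · congr 1
    refine Finset.sum_congr rfl fun i _ => Finset.sum_congr rfl fun j _ => ?_
    ring
  · ring

end Generator

section GeneratorIntegrable

variable {d : ℕ}

lemma continuous_fderiv_of_smooth {φ : Ed d → ℝ} (hφ : ContDiff ℝ (⊤ : ℕ∞) φ) :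
    Continuous (fderiv ℝ φ) := hφ.continuous_fderiv (by simp)

lemma smooth_fderiv_apply {φ : Ed d → ℝ} (hφ : ContDiff ℝ (⊤ : ℕ∞) φ) (m : Ed d) :
    ContDiff ℝ (⊤ : ℕ∞) fun z => fderiv ℝ φ z m :=
  (hφ.fderiv_right (m := (⊤ : ℕ∞)) (by simp)).clm_apply contDiff_const

lemma abs_increment_le {φ : Ed d → ℝ} {G : Ed d → ℂ} (hG : Continuous G)
    (hi : Integrable fun w => (1 + ‖w‖ ^ 2) * ‖G w‖)
    (h0 : ∀ x, (φ x : ℂ) = ∫ w, G w * wave w x)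
    (h1 : ∀ x m, (fderiv ℝ φ x m : ℂ) =
        ∫ w, G w * (2 * π * Complex.I * ((⟪w, m⟫ : ℝ) : ℂ)) * wave w x) (x y : Ed d) :
    |φ (x + y) - φ x - smallCut y * fderiv ℝ φ x y| ≤
      ((12 * π ^ 2 + 2) * ∫ w, (1 + ‖w‖ ^ 2) * ‖G w‖) * min 1 (‖y‖ ^ 2) := by
  rw [← Real.norm_eq_abs, ← Complex.norm_real, integral_freq_eq_increment hG hi h0 h1]
  refine (norm_integral_le_of_norm_le (hi.const_mul ((12 * π ^ 2 + 2) * min 1 (‖y‖ ^ 2)))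
    (ae_of_all _ fun w => ?_)).trans ?_
  · rw [norm_mul, norm_mul_wave]
    refine (mul_le_mul_of_nonneg_left (norm_waveKernel_le w y) (norm_nonneg (G w))).trans
      (le_of_eq ?_)
    ring
  · rw [integral_const_mul]
    apply le_of_eq
    ring

lemma integrable_increment {φ : Ed d → ℝ} (hφ : ContDiff ℝ (⊤ : ℕ∞) φ)
    (hc : HasCompactSupport φ) {ν : Measure (Ed d)} [SFinite ν]
    (hν : Integrable (fun y => min 1 (‖y‖ ^ 2)) ν) :
    Integrable (fun z : Ed d × Ed d =>
      φ (z.1 + z.2) - φ z.1 - smallCut z.2 * fderiv ℝ φ z.1 z.2) (volume.prod ν) := by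
  obtain ⟨G, hG, hi, h0, h1, -⟩ := exists_fourier_repr hφ hc
  have hφi : Integrable φ := hφ.continuous.integrable_of_hasCompactSupport hc
  have hdi : ∀ y, Integrable fun x => fderiv ℝ φ x y := fun y =>
    (smooth_fderiv_apply hφ y).continuous.integrable_of_hasCompactSupport (hc.fderiv_apply ℝ y)
  have hmeas : Measurable (fun z : Ed d × Ed d =>
      φ (z.1 + z.2) - φ z.1 - smallCut z.2 * fderiv ℝ φ z.1 z.2) := by
    have hd : Continuous fun z : Ed d × Ed d => fderiv ℝ φ z.1 z.2 :=
      ((continuous_fderiv_of_smooth hφ).comp continuous_fst).clm_apply continuous_snd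
    have hs : Continuous fun z : Ed d × Ed d => φ (z.1 + z.2) - φ z.1 := by
      have := hφ.continuous
      fun_prop
    exact hs.measurable.sub ((measurable_smallCut.comp measurable_snd).mul hd.measurable)
  have hDi : ∀ y, Integrable fun x => φ (x + y) - φ x - smallCut y * fderiv ℝ φ x y := fun y =>
    ((hφi.comp_add_right y).sub hφi).sub ((hdi y).const_mul _)
  rw [integrable_prod_iff' hmeas.aestronglyMeasurable]
  refine ⟨ae_of_all _ hDi, ?_⟩
  obtain ⟨R, hR⟩ := hc.isCompact.isBounded.subset_closedBall 0
  set C : ℝ := (12 * π ^ 2 + 2) * ∫ w, (1 + ‖w‖ ^ 2) * ‖G w‖ with hC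
  have hC0 : 0 ≤ C := mul_nonneg (by positivity) (integral_nonneg fun w => by positivity)
  refine (hν.const_mul (2 * (∫ x, ‖φ x‖) + C * volume.real (closedBall (0 : Ed d) (R + 1)))).mono'
    hmeas.norm.aestronglyMeasurable.prod_swap.integral_prod_right' (ae_of_all _ fun y => ?_)
  rw [Real.norm_of_nonneg (integral_nonneg fun x => norm_nonneg _)]
  have hφn : 0 ≤ ∫ x, ‖φ x‖ := integral_nonneg fun x => norm_nonneg _
  have hV : 0 ≤ volume.real (closedBall (0 : Ed d) (R + 1)) := measureReal_nonneg
  simp only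
  rcases le_or_gt 1 ‖y‖ with hy | hy
  · have e : ∫ x, ‖φ (x + y) - φ x - smallCut y * fderiv ℝ φ x y‖ ≤
        ∫ x, (‖φ (x + y)‖ + ‖φ x‖) := by
      refine integral_mono (hDi y).norm ((hφi.comp_add_right y).norm.add hφi.norm) fun x => ?_
      simp only [smallCut_of_one_le hy, zero_mul, sub_zero]
      exact norm_sub_le _ _
    rw [integral_add (hφi.comp_add_right y).norm hφi.norm,
      integral_add_right_eq_self (fun x => ‖φ x‖) y] at e
    rw [min_eq_left (one_le_pow₀ hy)]
    nlinarith [mul_nonneg hC0 hV]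
  · have e : ∫ x, ‖φ (x + y) - φ x - smallCut y * fderiv ℝ φ x y‖ ≤
        ∫ x, (closedBall (0 : Ed d) (R + 1)).indicator (fun _ => C * min 1 (‖y‖ ^ 2)) x := by
      refine integral_mono (hDi y).norm ?_ fun x => ?_
      · exact (integrable_indicator_iff measurableSet_closedBall).2
          (integrableOn_const measure_closedBall_lt_top.ne)
      · by_cases hx : x ∈ closedBall (0 : Ed d) (R + 1)
        · rw [Set.indicator_of_mem hx]
          exact abs_increment_le hG hi h0 h1 x y
        · rw [Set.indicator_of_notMem hx]
          rw [mem_closedBall_zero_iff, not_le] at hx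
          have hout : ∀ z : Ed d, R < ‖z‖ → z ∉ tsupport φ := fun z hz hz' => by
            have := hR hz'
            rw [mem_closedBall_zero_iff] at this
            linarith
          have t1 : φ (x + y) = 0 := by
            refine image_eq_zero_of_notMem_tsupport (hout _ ?_)
            have := norm_sub_le (x + y) y
            rw [add_sub_cancel_right] at this
            linarith
          have t2 : φ x = 0 := image_eq_zero_of_notMem_tsupport (hout _ (by linarith))
          have t3 : fderiv ℝ φ x = 0 := by
            by_contra hne
            exact hout x (by linarith) (support_fderiv_subset ℝ hne)
          simp [t1, t2, t3]
    rw [integral_indicator measurableSet_closedBall, setIntegral_const, smul_eq_mul] at e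
    have hm : 0 ≤ min 1 (‖y‖ ^ 2) := by positivity
    nlinarith [mul_nonneg hφn hm]

/-- The Lévy generator maps test functions to integrable functions. -/
lemma integrable_levyGen (b : Ed d) (Q : Matrix (Fin d) (Fin d) ℝ) {ν : Measure (Ed d)}
    [SFinite ν] (hν : Integrable (fun y => min 1 (‖y‖ ^ 2)) ν) {φ : Ed d → ℝ}
    (hφ : ContDiff ℝ (⊤ : ℕ∞) φ) (hc : HasCompactSupport φ) :
    Integrable (levyGen b Q ν φ) := by
  unfold levyGen
  simp_rw [inner_gradient_eq_fderiv]
  have hd : ∀ {f : Ed d → ℝ}, ContDiff ℝ (⊤ : ℕ∞) f → HasCompactSupport f → ∀ m,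
      Integrable fun x => fderiv ℝ f x m := fun hf hcf m =>
    (smooth_fderiv_apply hf m).continuous.integrable_of_hasCompactSupport (hcf.fderiv_apply ℝ m)
  refine ((hd hφ hc b).add (Integrable.const_mul ?_ _)).add
    (integrable_increment hφ hc hν).integral_prod_left
  exact integrable_finsetSum _ fun i _ => integrable_finsetSum _ fun j _ =>
    (hd (smooth_fderiv_apply hφ _) (hc.fderiv_apply ℝ _) _).const_mul _

/-- The Lévy generator commutes with translations. -/
lemma levyGen_comp_sub (b : Ed d) (Q : Matrix (Fin d) (Fin d) ℝ) (ν : Measure (Ed d))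
    (φ : Ed d → ℝ) (a x : Ed d) :
    levyGen b Q ν (fun z => φ (z - a)) x = levyGen b Q ν φ (x - a) := by
  unfold levyGen
  simp_rw [inner_gradient_eq_fderiv]
  have h : ∀ (f : Ed d → ℝ) z, fderiv ℝ (fun z => f (z - a)) z = fderiv ℝ f (z - a) :=
    fun f z => fderiv_comp_sub a
  simp_rw [h]
  congr 2
  · congr 1
    refine Finset.sum_congr rfl fun i _ => Finset.sum_congr rfl fun j _ => ?_
    rw [h (fun z => fderiv ℝ φ z (EuclideanSpace.single j 1)) x]
  · funext y
    rw [show x + y - a = x - a + y by abel]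

end GeneratorIntegrable

section Semigroup

variable {d : ℕ}

lemma integral_mul_wave_of_isTransDensity {b : Ed d} {Q : Matrix (Fin d) (Fin d) ℝ}
    {ν : Measure (Ed d)} {t : ℝ} {p : Ed d → ℝ} (hp : IsTransDensity b Q ν t p) (w : Ed d) :
    ∫ y, (p (y - (2 * t) • b) : ℂ) * wave w (-y) =
      Complex.exp (t * levySymbol (-b) Q (Measure.map Neg.neg ν) w) := by
  have h := hp.2.2 (-((2 * π) • w))
  have e1 : ∀ x : Ed d, Complex.exp (Complex.I * ((⟪-((2 * π) • w), x⟫ : ℝ) : ℂ)) =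
      wave w (-x) := by
    intro x
    rw [wave, inner_neg_left, inner_smul_left, inner_neg_right]
    congr 1
    simp only [conj_trivial]
    push_cast
    ring
  simp_rw [e1] at h
  rw [← integral_add_right_eq_self _ ((2 * t) • b)]
  simp only [add_sub_cancel_right]
  have e2 : ∀ y : Ed d, (p y : ℂ) * wave w (-(y + (2 * t) • b)) =
      wave w (-((2 * t) • b)) * (wave w (-y) * (p y : ℂ)) := by
    intro y
    rw [neg_add, wave_add]
    ring
  simp_rw [e2]
  rw [integral_const_mul, h]
  have e3 : levySymbol (-b) Q (Measure.map Neg.neg ν) w =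
      -charExp b Q ν (-((2 * π) • w)) - 4 * π * Complex.I * ((⟪w, b⟫ : ℝ) : ℂ) := by
    have hker : ∫ y, waveKernel w y ∂(Measure.map Neg.neg ν) = -∫ y,
        (1 - Complex.exp (Complex.I * ((⟪y, -((2 * π) • w)⟫ : ℝ) : ℂ))
        + Complex.I * ((⟪y, -((2 * π) • w)⟫ : ℝ) : ℂ) * (smallCut y : ℂ)) ∂ν := by
      rw [← integral_neg]
      refine ((MeasurableEquiv.neg (Ed d)).measurableEmbedding.integral_map
        (μ := ν) (fun y => waveKernel w y)).trans ?_
      refine integral_congr_ae (ae_of_all _ fun y => ?_)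
      have hs : smallCut (-y) = smallCut y := by simp [smallCut]
      simp only [MeasurableEquiv.neg_apply, waveKernel, hs]
      rw [real_inner_comm _ y, e1, inner_neg_right, inner_neg_left, inner_smul_left]
      simp only [conj_trivial]
      push_cast
      ring
    rw [levySymbol, charExp, hker]
    have hQ : (∑ i, ∑ j, (Q i j : ℂ) *
        ((2 * π * Complex.I * (w i : ℂ)) * (2 * π * Complex.I * (w j : ℂ)))) =
        -((∑ i, ∑ j, (-((2 * π) • w)) i * Q i j * (-((2 * π) • w)) j : ℝ) : ℂ) := by
      push_cast
      rw [← Finset.sum_neg_distrib]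
      refine Finset.sum_congr rfl fun i _ => ?_
      rw [← Finset.sum_neg_distrib]
      refine Finset.sum_congr rfl fun j _ => ?_
      simp only [PiLp.neg_apply, PiLp.smul_apply, smul_eq_mul]
      push_cast
      linear_combination (4 * π ^ 2 * (w i : ℂ) * (w j : ℂ) * (Q i j : ℂ)) * Complex.I_sq
    rw [hQ, inner_neg_right, inner_neg_right, inner_smul_right, real_inner_comm w b]
    push_cast
    ring
  rw [e3, wave, ← Complex.exp_add, inner_neg_right, inner_smul_right]
  congr 1
  push_cast
  ring

/-- A family of probability densities `q t`, `t > 0`, whose Fourier transforms are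
`exp (t σ)`. -/
structure IsDensityFamily (σ : Ed d → ℂ) (q : ℝ → Ed d → ℝ) : Prop where
  nonneg : ∀ t, 0 < t → ∀ y, 0 ≤ q t y
  integral_eq_one : ∀ t, 0 < t → ∫ y, q t y = 1
  integral_mul_wave : ∀ t, 0 < t → ∀ w, ∫ y, (q t y : ℂ) * wave w (-y) = Complex.exp (t * σ w)

namespace IsDensityFamily

variable {σ : Ed d → ℂ} {q : ℝ → Ed d → ℝ} {t : ℝ}

lemma integrable (hq : IsDensityFamily σ q) (ht : 0 < t) : Integrable (q t) :=
  integrable_of_integral_eq_one (hq.integral_eq_one t ht)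

lemma norm_exp_le_one (hq : IsDensityFamily σ q) (ht : 0 < t) (w : Ed d) :
    ‖Complex.exp (t * σ w)‖ ≤ 1 := by
  rw [← hq.integral_mul_wave t ht, ← hq.integral_eq_one t ht]
  refine norm_integral_le_of_norm_le (hq.integrable ht) (ae_of_all _ fun y => ?_)
  rw [norm_mul_wave, Complex.norm_real, Real.norm_of_nonneg (hq.nonneg t ht y)]

lemma integral_mul_repr (hq : IsDensityFamily σ q) (ht : 0 < t) {f : Ed d → ℝ} {h : Ed d → ℂ}
    (hh : Integrable h) (hf : ∀ x, (f x : ℂ) = ∫ w, h w * wave w x) (x : Ed d) :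
    ((∫ y, q t y * f (x - y) : ℝ) : ℂ) = ∫ w, h w * wave w x * Complex.exp (t * σ w) := by
  have hker : Integrable (fun z : Ed d × Ed d => (q t z.1 : ℂ) * (h z.2 * wave z.2 (x - z.1)))
      (volume.prod volume) := by
    have hp := ((hq.integrable ht).ofReal (𝕜 := ℂ)).mul_prod hh
    have hm : Measurable fun z : Ed d × Ed d => wave z.2 (x - z.1) :=
      (continuous_wave.comp (by fun_prop :
        Continuous fun z : Ed d × Ed d => (z.2, x - z.1))).measurable
    refine hp.norm.mono' ?_ (ae_of_all _ fun z => ?_)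
    · exact (hp.aestronglyMeasurable.mul hm.aestronglyMeasurable).congr
        (ae_of_all _ fun z => by simp [mul_assoc])
    · rw [norm_mul, norm_mul_wave, norm_mul]
      rfl
  rw [← integral_complex_ofReal]
  push_cast
  simp_rw [hf, ← integral_const_mul]
  rw [integral_integral_swap hker]
  refine integral_congr_ae (ae_of_all _ fun w => ?_)
  simp only
  rw [← hq.integral_mul_wave t ht, ← integral_const_mul]
  refine integral_congr_ae (ae_of_all _ fun y => ?_)
  simp only
  rw [wave_sub]
  ring

end IsDensityFamily

lemma integral_mul_exp_eq (z : ℂ) {t : ℝ} (ht : 0 ≤ t) :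
    ∫ s in Set.Ioc 0 t, z * Complex.exp (s * z) = Complex.exp (t * z) - 1 := by
  rw [← intervalIntegral.integral_of_le ht]
  by_cases hz : z = 0
  · simp [hz]
  · rw [intervalIntegral.integral_const_mul]
    simp_rw [mul_comm _ z]
    rw [integral_exp_mul_complex hz]
    field_simp
    simp

lemma integrable_conv_prod {f g : Ed d → ℝ} (hf : Integrable f) (hg : Integrable g) :
    Integrable (fun z : Ed d × Ed d => f z.2 * g (z.1 - z.2)) (volume.prod volume) :=
  hf.convolution_integrand (ContinuousLinearMap.mul ℝ ℝ) hg

lemma integral_norm_conv_le {f g : Ed d → ℝ} (hf : Integrable f) (hg : Integrable g) :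
    ∫ x, ‖∫ y, f y * g (x - y)‖ ≤ (∫ y, ‖f y‖) * ∫ x, ‖g x‖ := by
  have hi := integrable_conv_prod hf hg
  calc ∫ x, ‖∫ y, f y * g (x - y)‖ ≤ ∫ x, ∫ y, ‖f y * g (x - y)‖ :=
        integral_mono hi.integral_prod_left.norm hi.norm.integral_prod_left
          fun x => norm_integral_le_integral_norm _
    _ = ∫ y, ∫ x, ‖f y * g (x - y)‖ := integral_integral_swap hi.norm
    _ = (∫ y, ‖f y‖) * ∫ x, ‖g x‖ := by
        simp_rw [norm_mul, integral_const_mul,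
          integral_sub_right_eq_self (fun x => ‖g x‖)]
        rw [integral_mul_const]

lemma integral_mul_conv {u f g : Ed d → ℝ} (hu : Measurable u) {K : ℝ} (hK : ∀ x, |u x| ≤ K)
    (hf : Integrable f) (hg : Integrable g) :
    ∫ x, u x * ∫ y, f y * g (x - y) = ∫ y, f y * ∫ x, u x * g (x - y) := by
  have hi := integrable_conv_prod hf hg
  have hi2 : Integrable (fun z : Ed d × Ed d => u z.1 * (f z.2 * g (z.1 - z.2)))
      (volume.prod volume) :=
    hi.bdd_mul (c := K) (hu.comp measurable_fst).aestronglyMeasurable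
      (ae_of_all _ fun z => hK z.1)
  simp_rw [← integral_const_mul]
  rw [integral_integral_swap hi2]
  refine integral_congr_ae (ae_of_all _ fun y => integral_congr_ae (ae_of_all _ fun x => ?_))
  simp only
  ring

/-- The integrand of the Fourier representation of the semigroup with symbol `σ` applied to a
function with Fourier transform `h`. -/
def flowKernel (σ h : Ed d → ℂ) (s : ℝ) (x w : Ed d) : ℂ :=
  h w * wave w x * Complex.exp (s * σ w)

lemma measurable_flowKernel {σ h : Ed d → ℂ} (hσ : Measurable σ) (hh : Measurable h) :
    Measurable fun z : (ℝ × Ed d) × Ed d => flowKernel σ h z.1.1 z.1.2 z.2 := by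
  have h1 : Measurable fun z : (ℝ × Ed d) × Ed d => wave z.2 z.1.2 :=
    (continuous_wave.comp (by fun_prop :
      Continuous fun z : (ℝ × Ed d) × Ed d => (z.2, z.1.2))).measurable
  have h2 : Measurable fun z : (ℝ × Ed d) × Ed d => (z.1.1 : ℂ) * σ z.2 :=
    (Complex.measurable_ofReal.comp (measurable_fst.comp measurable_fst)).mul
      (hσ.comp measurable_snd)
  exact ((hh.comp measurable_snd).mul h1).mul (Complex.measurable_exp.comp h2)

lemma norm_flowKernel_le {σ : Ed d → ℂ} {q : ℝ → Ed d → ℝ} (hq : IsDensityFamily σ q)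
    (h : Ed d → ℂ) {s : ℝ} (hs : 0 < s) (x w : Ed d) : ‖flowKernel σ h s x w‖ ≤ ‖h w‖ := by
  rw [flowKernel, norm_mul, norm_mul_wave]
  exact mul_le_of_le_one_right (norm_nonneg _) (hq.norm_exp_le_one hs _)

lemma integral_sub_eq_integral_flowKernel {σ : Ed d → ℂ} (hσ : Measurable σ)
    {q : ℝ → Ed d → ℝ} (hq : IsDensityFamily σ q) {φ : Ed d → ℝ} {G : Ed d → ℂ}
    (hG : Measurable G) (hGi : Integrable G) (hGσ : Integrable fun w => G w * σ w)
    (h0 : ∀ x, (φ x : ℂ) = ∫ w, G w * wave w x) {t : ℝ} (ht : 0 < t) (x : Ed d) :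
    (((∫ y, q t y * φ (x - y)) - φ x : ℝ) : ℂ) =
      ∫ s in Set.Ioc 0 t, ∫ w, flowKernel σ (fun w => G w * σ w) s x w := by
  have hGσm : Measurable fun w => G w * σ w := hG.mul hσ
  have hprod : Integrable (fun z : ℝ × Ed d => flowKernel σ (fun w => G w * σ w) z.1 x z.2)
      ((volume.restrict (Set.Ioc 0 t)).prod volume) := by
    have hp := (integrable_const (μ := volume.restrict (Set.Ioc 0 t)) (1 : ℂ)).mul_prod hGσ
    have hc : Measurable fun z : ℝ × Ed d => (((z.1, x), z.2) : (ℝ × Ed d) × Ed d) :=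
      (measurable_fst.prodMk measurable_const).prodMk measurable_snd
    have hm : Measurable fun z : ℝ × Ed d => flowKernel σ (fun w => G w * σ w) z.1 x z.2 := by
      have hk := measurable_flowKernel hσ hGσm
      generalize flowKernel σ (fun w => G w * σ w) = k at hk ⊢
      exact hk.comp hc
    refine hp.norm.mono' hm.aestronglyMeasurable ?_
    have hs : ∀ᵐ z ∂((volume.restrict (Set.Ioc 0 t)).prod (volume : Measure (Ed d))),
        z.1 ∈ Set.Ioc 0 t :=
      Measure.quasiMeasurePreserving_fst.ae (ae_restrict_mem measurableSet_Ioc)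
    filter_upwards [hs] with z hz
    rw [one_mul]
    exact norm_flowKernel_le hq _ hz.1 _ _
  have hw : Measurable fun w => G w * wave w x := hG.mul (measurable_wave_left x)
  rw [integral_integral_swap hprod, Complex.ofReal_sub, hq.integral_mul_repr ht hGi h0 x, h0,
    ← integral_sub]
  · refine integral_congr_ae (ae_of_all _ fun w => ?_)
    have : ∀ s : ℝ, flowKernel σ (fun w => G w * σ w) s x w =
        G w * wave w x * (σ w * Complex.exp (s * σ w)) := fun s => by
      rw [flowKernel]; ring
    simp only [this]
    rw [integral_const_mul, integral_mul_exp_eq _ ht.le]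
    ring
  · refine hGi.norm.mono' (Measurable.aestronglyMeasurable ?_)
      (ae_of_all _ (norm_flowKernel_le hq _ ht x))
    exact hw.mul (Complex.measurable_exp.comp (hσ.const_mul _))
  · exact hGi.norm.mono' hw.aestronglyMeasurable (ae_of_all _ fun w => (norm_mul_wave _ _ _).le)

lemma integrable_mul_prod_of_conv {q : ℝ → Ed d → ℝ} (hqi : ∀ s, 0 < s → Integrable (q s))
    (hqn : ∀ s, 0 < s → ∫ y, ‖q s y‖ = 1) {A : Ed d → ℝ} (hAi : Integrable A)
    {u : Ed d → ℝ} (hu : Measurable u) {K : ℝ} (hK : ∀ x, |u x| ≤ K) (t : ℝ)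
    {F : ℝ → Ed d → ℂ} (hFm : Measurable fun z : ℝ × Ed d => F z.1 z.2)
    (hF : ∀ s, 0 < s → ∀ x, F s x = ((∫ y, q s y * A (x - y) : ℝ) : ℂ)) :
    Integrable (fun z : Ed d × ℝ => (u z.1 : ℂ) * F z.2 z.1)
      ((volume : Measure (Ed d)).prod (volume.restrict (Set.Ioc 0 t))) := by
  have hm : Measurable fun z : Ed d × ℝ => (u z.1 : ℂ) * F z.2 z.1 :=
    (Complex.measurable_ofReal.comp (hu.comp measurable_fst)).mul (hFm.comp measurable_swap)
  have hci : ∀ s, 0 < s → Integrable fun x => ∫ y, q s y * A (x - y) :=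
    fun s hs => (integrable_conv_prod (hqi s hs) hAi).integral_prod_left
  have hK0 : 0 ≤ K := (abs_nonneg _).trans (hK 0)
  rw [integrable_prod_iff' hm.aestronglyMeasurable]
  constructor
  · refine ae_restrict_of_forall_mem measurableSet_Ioc fun s hs => ?_
    simp only [hF s hs.1]
    exact (hci s hs.1).ofReal.bdd_mul (c := K)
      (Complex.measurable_ofReal.comp hu).aestronglyMeasurable
      (ae_of_all _ fun x => by simpa using hK x)
  · refine (integrable_const (K * ∫ x, ‖A x‖)).mono'
      (hm.norm.stronglyMeasurable.integral_prod_left').aestronglyMeasurable ?_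
    refine ae_restrict_of_forall_mem measurableSet_Ioc fun s hs => ?_
    rw [Real.norm_of_nonneg (integral_nonneg fun x => norm_nonneg _)]
    simp only [hF s hs.1]
    have h1 := integral_norm_conv_le (hqi s hs.1) hAi
    rw [hqn s hs.1, one_mul] at h1
    calc _ ≤ ∫ x, K * ‖∫ y, q s y * A (x - y)‖ := by
          refine integral_mono_of_nonneg (ae_of_all _ fun x => norm_nonneg _)
            ((hci s hs.1).norm.const_mul K) (ae_of_all _ fun x => ?_)
          simp only [norm_mul, Complex.norm_real]
          exact mul_le_mul_of_nonneg_right (hK x) (norm_nonneg _)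
      _ ≤ K * ∫ x, ‖A x‖ := by
          rw [integral_const_mul]
          exact mul_le_mul_of_nonneg_left h1 hK0

/-- If `u` annihilates all translates of the generator applied to `φ`, then it annihilates
the increment of the semigroup applied to `φ`. -/
lemma integral_mul_semigroup_sub_eq_zero {σ : Ed d → ℂ} (hσ : Measurable σ) {C : ℝ}
    (hC : ∀ w, ‖σ w‖ ≤ C * (1 + ‖w‖ ^ 2)) {q : ℝ → Ed d → ℝ} (hq : IsDensityFamily σ q)
    {φ A : Ed d → ℝ} {G : Ed d → ℂ} (hG : Continuous G)
    (hi : Integrable fun w => (1 + ‖w‖ ^ 2) * ‖G w‖)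
    (h0 : ∀ x, (φ x : ℂ) = ∫ w, G w * wave w x)
    (hA : ∀ x, (A x : ℂ) = ∫ w, G w * σ w * wave w x) (hAi : Integrable A)
    {u : Ed d → ℝ} (hu : Measurable u) {K : ℝ} (hK : ∀ x, |u x| ≤ K)
    (huA : ∀ a, ∫ x, u x * A (x - a) = 0) {t : ℝ} (ht : 0 < t) :
    ∫ x, u x * ((∫ y, q t y * φ (x - y)) - φ x) = 0 := by
  have hGi : Integrable G := by
    have := integrable_mul_of_norm_le hG hi (h := fun _ => 1) (C := 1) measurable_const
      fun w => by rw [norm_one]; nlinarith [sq_nonneg ‖w‖]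
    simpa using this
  have hGσ : Integrable fun w => G w * σ w := integrable_mul_of_norm_le hG hi hσ hC
  have hGσm : Measurable fun w => G w * σ w := hG.measurable.mul hσ
  have hKm := ((measurable_flowKernel hσ
    hGσm).stronglyMeasurable.integral_prod_right' (ν := volume)).measurable
  have hKeq : ∀ s, 0 < s → ∀ x, ∫ w, flowKernel σ (fun w => G w * σ w) s x w =
      ((∫ y, q s y * A (x - y) : ℝ) : ℂ) :=
    fun s hs x => (hq.integral_mul_repr hs hGσ hA x).symm
  have hqn : ∀ s, 0 < s → ∫ y, ‖q s y‖ = 1 := fun s hs => by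
    rw [← hq.integral_eq_one s hs]
    exact integral_congr_ae (ae_of_all _ fun y => Real.norm_of_nonneg (hq.nonneg s hs y))
  have hident := integral_sub_eq_integral_flowKernel hσ hq hG.measurable hGi hGσ h0 ht
  generalize hFdef : (fun (s : ℝ) (x : Ed d) =>
    ∫ w, flowKernel σ (fun w => G w * σ w) s x w) = F
  have hF' : ∀ s x, ∫ w, flowKernel σ (fun w => G w * σ w) s x w = F s x := fun s x => by
    rw [← hFdef]
  simp only [hF'] at hKeq hident
  have hFm : Measurable fun z : ℝ × Ed d => F z.1 z.2 := by
    rw [← hFdef]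
    exact hKm
  have hfub := integrable_mul_prod_of_conv (fun s hs => hq.integrable hs) hqn hAi hu hK t hFm hKeq
  rw [← Complex.ofReal_eq_zero, ← integral_complex_ofReal]
  simp_rw [Complex.ofReal_mul, hident, ← integral_const_mul]
  rw [integral_integral_swap hfub]
  refine integral_eq_zero_of_ae (ae_restrict_of_forall_mem measurableSet_Ioc fun s hs => ?_)
  simp only [hKeq s hs.1, Pi.zero_apply]
  simp_rw [← Complex.ofReal_mul]
  rw [integral_complex_ofReal, integral_mul_conv hu hK (hq.integrable hs.1) hAi]
  simp [huA]

end Semigroup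

section ChoquetDeny

variable {d : ℕ}

lemma integrable_of_abs_le {α : Type*} [MeasurableSpace α] {μ : Measure α} [IsFiniteMeasure μ]
    {f : α → ℝ} (hf : Measurable f) {M : ℝ} (hM : ∀ x, |f x| ≤ M) : Integrable f μ :=
  Integrable.of_bound hf.aestronglyMeasurable M (ae_of_all _ hM)

lemma integral_sub_integral_sq {α : Type*} [MeasurableSpace α] {μ : Measure α}
    [IsProbabilityMeasure μ] {f : α → ℝ} (hf : Integrable f μ)
    (hf2 : Integrable (fun x => f x ^ 2) μ) :
    ∫ x, (f x - ∫ z, f z ∂μ) ^ 2 ∂μ = ∫ x, f x ^ 2 ∂μ - (∫ x, f x ∂μ) ^ 2 := by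
  set m := ∫ z, f z ∂μ
  have e : ∀ x, (f x - m) ^ 2 = (f x ^ 2 - 2 * m * f x) + m ^ 2 := fun x => by ring
  simp_rw [e]
  have h1 : Integrable (fun x => 2 * m * f x) μ := hf.const_mul _
  have h2 : Integrable (fun x => f x ^ 2 - 2 * m * f x) μ := hf2.sub h1
  rw [integral_add h2 (integrable_const _), integral_sub hf2 h1, integral_const_mul,
    integral_const]
  simp only [probReal_univ, one_smul]
  ring

lemma sq_integral_le {α : Type*} [MeasurableSpace α] {μ : Measure α}
    [IsProbabilityMeasure μ] {f : α → ℝ} (hf : Integrable f μ)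
    (hf2 : Integrable (fun x => f x ^ 2) μ) :
    (∫ x, f x ∂μ) ^ 2 ≤ ∫ x, f x ^ 2 ∂μ := by
  have h := integral_sub_integral_sq hf hf2
  have h0 : 0 ≤ ∫ x, (f x - ∫ z, f z ∂μ) ^ 2 ∂μ := integral_nonneg fun x => sq_nonneg _
  linarith

/-- A bounded function that is harmonic for convolution by a probability measure `μ` is
invariant under `μ`-almost every translation. -/
lemma ae_add_eq_of_harmonic {μ : Measure (Ed d)} [IsProbabilityMeasure μ] {v : Ed d → ℝ}
    (hvm : Measurable v) {M : ℝ} (hM : ∀ x, |v x| ≤ M) (hv : ∀ x, v x = ∫ y, v (x + y) ∂μ)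
    (x : Ed d) : ∀ᵐ y ∂μ, v (x + y) = v x := by
  have hM0 : 0 ≤ M := (abs_nonneg _).trans (hM 0)
  have hadd : ∀ x : Ed d, Measurable fun y => v (x + y) := fun x =>
    hvm.comp (measurable_const_add x)
  have hsq : ∀ x, |v x ^ 2| ≤ M ^ 2 := fun x => by
    rw [abs_of_nonneg (sq_nonneg _)]
    exact sq_le_sq' (abs_le.1 (hM x)).1 (abs_le.1 (hM x)).2
  have hi : ∀ x, Integrable (fun y => v (x + y)) μ := fun x =>
    integrable_of_abs_le (hadd x) fun y => hM _
  have hi2 : ∀ x, Integrable (fun y => v (x + y) ^ 2) μ := fun x =>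
    integrable_of_abs_le ((hadd x).pow_const 2) fun y => hsq _
  set Γ : Ed d → ℝ := fun x => ∫ y, (v (x + y) - v x) ^ 2 ∂μ with hΓ
  have hbd : ∀ x y, |(v (x + y) - v x) ^ 2| ≤ 4 * M ^ 2 := fun x y => by
    rw [abs_of_nonneg (sq_nonneg _)]
    have h1 := abs_le.1 (hM (x + y))
    have h2 := abs_le.1 (hM x)
    nlinarith
  have hjm : Measurable fun z : Ed d × Ed d => (v (z.1 + z.2) - v z.1) ^ 2 :=
    ((hvm.comp (measurable_fst.add measurable_snd)).sub (hvm.comp measurable_fst)).pow_const 2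
  have hΓm : Measurable Γ := (hjm.stronglyMeasurable.integral_prod_right' (ν := μ)).measurable
  have hΓ0 : ∀ x, 0 ≤ Γ x := fun x => integral_nonneg fun y => sq_nonneg _
  have hΓi : ∀ x, Integrable (fun y => Γ (x + y)) μ := fun x =>
    integrable_of_abs_le (M := 4 * M ^ 2) (hΓm.comp (measurable_const_add x)) fun y => by
      have h := norm_integral_le_of_norm_le_const (μ := μ) (C := 4 * M ^ 2)
        (f := fun z => (v (x + y + z) - v (x + y)) ^ 2) (ae_of_all _ (hbd (x + y)))
      simpa using h
  have hΓeq : ∀ x, Γ x = ∫ y, v (x + y) ^ 2 ∂μ - v x ^ 2 := fun x => by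
    have h := integral_sub_integral_sq (hi x) (hi2 x)
    rw [← hv x] at h
    exact h
  have hsub : ∀ x, Γ x ≤ ∫ z, Γ (x + z) ∂μ := fun x => by
    have hpm : Measurable fun z : Ed d × Ed d => (v (x + z.2 + z.1) - v (x + z.2)) ^ 2 := by
      have h1 : Measurable fun z : Ed d × Ed d => x + z.2 := measurable_snd.const_add x
      exact ((hvm.comp (h1.add measurable_fst)).sub (hvm.comp h1)).pow_const 2
    have hpi : Integrable (fun z : Ed d × Ed d => (v (x + z.2 + z.1) - v (x + z.2)) ^ 2)
        (μ.prod μ) := integrable_of_abs_le hpm fun z => hbd _ _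
    calc Γ x ≤ ∫ y, ∫ z, (v (x + z + y) - v (x + z)) ^ 2 ∂μ ∂μ := by
          refine integral_mono (integrable_of_abs_le
            (((hadd x).sub measurable_const).pow_const 2) (hbd x)) hpi.integral_prod_left
            fun y => ?_
          have e : v (x + y) - v x = ∫ z, (v (x + z + y) - v (x + z)) ∂μ := by
            have h1 : Integrable (fun z => v (x + z + y)) μ := by
              simpa only [add_right_comm] using hi (x + y)
            rw [integral_sub h1 (hi x), ← hv x, hv (x + y)]
            simp only [add_right_comm]
          have hm : Measurable fun z => v (x + z + y) - v (x + z) :=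
            (hvm.comp ((measurable_const_add x).add_const y)).sub (hadd x)
          simp only
          rw [e]
          refine sq_integral_le (integrable_of_abs_le (M := 2 * M) hm fun z => ?_)
            (integrable_of_abs_le (hm.pow_const 2) fun z => hbd _ _)
          have h1 := abs_le.1 (hM (x + z + y))
          have h2 := abs_le.1 (hM (x + z))
          exact abs_le.2 ⟨by linarith, by linarith⟩
      _ = ∫ z, Γ (x + z) ∂μ := integral_integral_swap hpi
  have hind : ∀ n : ℕ, ∀ x, v x ^ 2 + n * Γ x ≤ M ^ 2 := by
    intro n
    induction n with
    | zero => intro x; simpa using (abs_le.1 (hsq x)).2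
    | succ n ih =>
      intro x
      have h1 : ∫ y, (v (x + y) ^ 2 + n * Γ (x + y)) ∂μ ≤ ∫ _, M ^ 2 ∂μ :=
        integral_mono ((hi2 x).add ((hΓi x).const_mul _)) (integrable_const _) fun y => ih _
      rw [integral_add (hi2 x) ((hΓi x).const_mul _), integral_const_mul, integral_const,
        probReal_univ, one_smul] at h1
      have h2 := mul_le_mul_of_nonneg_left (hsub x) (Nat.cast_nonneg (α := ℝ) n)
      push_cast
      linarith [hΓeq x]
  have hz : Γ x = 0 := by
    by_contra hne
    have hpos : 0 < Γ x := lt_of_le_of_ne (hΓ0 x) (Ne.symm hne)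
    obtain ⟨n, hn⟩ := exists_nat_gt (M ^ 2 / Γ x)
    rw [div_lt_iff₀ hpos] at hn
    linarith [hind n x, sq_nonneg (v x)]
  have := (integral_eq_zero_iff_of_nonneg (fun y => sq_nonneg _) (integrable_of_abs_le
    (((hadd x).sub measurable_const).pow_const 2) (hbd x))).1 hz
  filter_upwards [this] with y hy
  have hy' : (v (x + y) - v x) ^ 2 = 0 := hy
  exact sub_eq_zero.1 (pow_eq_zero_iff two_ne_zero |>.1 hy')

/-- A bounded continuous function that is harmonic for convolution by a continuous probability
density is constant. -/
lemma eq_of_harmonic {q v : Ed d → ℝ} (hqc : Continuous q) (hq0 : ∀ y, 0 ≤ q y)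
    (hq1 : ∫ y, q y = 1) (hvc : Continuous v) {M : ℝ} (hM : ∀ x, |v x| ≤ M)
    (hv : ∀ x, v x = ∫ y, q y * v (x + y)) (x y : Ed d) : v x = v y := by
  have hqm : Measurable fun y => ENNReal.ofReal (q y) := hqc.measurable.ennreal_ofReal
  have hqi : Integrable q := integrable_of_integral_eq_one hq1
  set μ : Measure (Ed d) := volume.withDensity fun y => ENNReal.ofReal (q y) with hμ
  have : IsProbabilityMeasure μ := ⟨by
    rw [hμ, withDensity_apply _ MeasurableSet.univ, Measure.restrict_univ,
      ← ofReal_integral_eq_lintegral_ofReal hqi (ae_of_all _ hq0), hq1, ENNReal.ofReal_one]⟩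
  have hv' : ∀ x, v x = ∫ y, v (x + y) ∂μ := fun x => by
    rw [hμ, integral_withDensity_eq_integral_toReal_smul hqm
      (ae_of_all _ fun _ => ENNReal.ofReal_lt_top), hv x]
    simp only [ENNReal.toReal_ofReal (hq0 _), smul_eq_mul]
  obtain ⟨y₀, hy₀⟩ : ∃ y₀, 0 < q y₀ := by
    by_contra! h
    have : q = fun _ => 0 := funext fun y => le_antisymm (h y) (hq0 y)
    rw [this] at hq1
    simp at hq1
  obtain ⟨r, hr, hball⟩ := Metric.isOpen_iff.1 (isOpen_lt continuous_const hqc) y₀ hy₀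
  have key : ∀ x, ∀ z ∈ ball y₀ r, v (x + z) = v x := by
    intro x
    have h := ae_add_eq_of_harmonic hvc.measurable hM hv' x
    rw [hμ, ae_withDensity_iff hqm] at h
    have h2 : ∀ᵐ z ∂(volume.restrict (ball y₀ r)), v (x + z) = v x := by
      refine (ae_restrict_iff' measurableSet_ball).2 ?_
      filter_upwards [h] with z hz hzb
      exact hz (ENNReal.ofReal_pos.2 (hball hzb)).ne'
    exact Measure.eqOn_open_of_ae_eq (f := fun z => v (x + z)) (g := fun _ => v x) h2 isOpen_ball
      (by fun_prop) continuousOn_const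
  have hloc : IsLocallyConstant v := by
    rw [IsLocallyConstant.iff_eventually_eq]
    intro x
    filter_upwards [ball_mem_nhds x hr] with x' hx'
    have h1 := key (x - y₀) y₀ (mem_ball_self hr)
    have h2 := key (x - y₀) (x' - x + y₀) (by simpa [dist_eq_norm] using hx')
    have e1 : x - y₀ + y₀ = x := by abel
    have e2 : x - y₀ + (x' - x + y₀) = x' := by abel
    rw [e1] at h1
    rw [e2] at h2
    rw [h1, h2]
  exact hloc.apply_eq_of_preconnectedSpace x y

end ChoquetDeny

section Liouville

variable {d : ℕ}

lemma exists_isDensityFamily {b : Ed d} {Q : Matrix (Fin d) (Fin d) ℝ} {ν : Measure (Ed d)}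
    (hC1 : ∀ t : ℝ, 0 < t → ∃ p : Ed d → ℝ, Continuous p ∧ (∃ K : ℝ, ∀ x, p x ≤ K) ∧
      IsTransDensity b Q ν t p) :
    ∃ q : ℝ → Ed d → ℝ, IsDensityFamily (levySymbol (-b) Q (Measure.map Neg.neg ν)) q ∧
      ∀ t, 0 < t → Continuous (q t) := by
  choose! p hpc _ hp using hC1
  refine ⟨fun t y => p t (y - (2 * t) • b), ⟨fun t ht y => (hp t ht).1 _, fun t ht => ?_,
    fun t ht w => integral_mul_wave_of_isTransDensity (hp t ht) w⟩, fun t ht => ?_⟩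
  · rw [integral_sub_right_eq_self (p t)]
    exact (hp t ht).2.1
  · have := hpc t ht
    fun_prop

lemma map_neg_singleton_zero {ν : Measure (Ed d)} (h : ν {0} = 0) :
    Measure.map Neg.neg ν {0} = 0 := by
  rw [Measure.map_apply measurable_neg (measurableSet_singleton 0)]
  simpa using h

lemma integrable_min_map_neg {ν : Measure (Ed d)}
    (h : Integrable (fun y => min 1 (‖y‖ ^ 2)) ν) :
    Integrable (fun y => min 1 (‖y‖ ^ 2)) (Measure.map Neg.neg ν) := by
  have hm : Measurable fun y : Ed d => min 1 (‖y‖ ^ 2) := by fun_prop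
  rw [integrable_map_measure hm.aestronglyMeasurable measurable_neg.aemeasurable]
  exact h.congr (ae_of_all _ fun y => by simp)

lemma comp_sub_smooth {φ : Ed d → ℝ} (hφ : ContDiff ℝ (⊤ : ℕ∞) φ) (a : Ed d) :
    ContDiff ℝ (⊤ : ℕ∞) fun z => φ (z - a) := hφ.comp (contDiff_id.sub contDiff_const)

lemma comp_sub_hasCompactSupport {φ : Ed d → ℝ} (hc : HasCompactSupport φ) (a : Ed d) :
    HasCompactSupport fun z => φ (z - a) :=
  hc.comp_homeomorph (Homeomorph.subRight a)

/-- A weak solution of `A u = 0`, averaged against a test function, is harmonic for the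
transition densities. -/
lemma integral_mul_eq_integral_density_mul {b : Ed d} {Q : Matrix (Fin d) (Fin d) ℝ}
    {ν : Measure (Ed d)} (hT : IsLevyTriplet b Q ν) {q : ℝ → Ed d → ℝ}
    (hq : IsDensityFamily (levySymbol (-b) Q (Measure.map Neg.neg ν)) q) {u : Ed d → ℝ}
    (hu : Measurable u) {K : ℝ} (hK : ∀ x, |u x| ≤ K) (hweak : IsWeakSolZero b Q ν u)
    {φ : Ed d → ℝ} (hφ : ContDiff ℝ (⊤ : ℕ∞) φ) (hc : HasCompactSupport φ) {t : ℝ}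
    (ht : 0 < t) (x : Ed d) :
    ∫ z, u z * φ (z - x) = ∫ y, q t y * ∫ z, u z * φ (z - (x + y)) := by
  have hν := integrable_min_map_neg (integrable_min_one_sq hT.nuFin)
  have := sigmaFinite_of_integrable_min (map_neg_singleton_zero hT.nuZero) hν
  have hφx := comp_sub_smooth hφ x
  have hcx := comp_sub_hasCompactSupport hc x
  obtain ⟨G, hG, hi, h0, h1, h2⟩ := exists_fourier_repr hφx hcx
  obtain ⟨C, hC⟩ := exists_norm_levySymbol_le (-b) Q hν
  have hAi := integrable_levyGen (-b) Q hν hφx hcx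
  have key := integral_mul_semigroup_sub_eq_zero (measurable_levySymbol (-b) Q _) hC hq hG hi h0
    (levyGen_eq_integral (-b) Q hν hG hi h0 h1 h2) hAi hu hK (fun a => by
      simp_rw [← levyGen_comp_sub]
      exact hweak _ (comp_sub_smooth hφx a) (comp_sub_hasCompactSupport hcx a)) ht
  have hφi : Integrable fun z => φ (z - x) := hφx.continuous.integrable_of_hasCompactSupport hcx
  have hbdd : ∀ {f : Ed d → ℝ}, Integrable f → Integrable fun z => u z * f z := fun hf =>
    hf.bdd_mul (c := K) hu.aestronglyMeasurable (ae_of_all _ hK)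
  have hci := (integrable_conv_prod (hq.integrable ht) hφi).integral_prod_left
  simp_rw [mul_sub] at key
  rw [integral_sub (hbdd hci) (hbdd hφi), sub_eq_zero,
    integral_mul_conv hu hK (hq.integrable ht) hφi] at key
  rw [← key]
  simp only [sub_sub, add_comm x]

lemma continuous_integral_mul_comp_sub {u φ : Ed d → ℝ} (hu : LocallyIntegrable u)
    (hφ : Continuous φ) (hc : HasCompactSupport φ) :
    Continuous fun x => ∫ z, u z * φ (z - x) := by
  have h := (hc.comp_homeomorph (Homeomorph.neg (Ed d))).continuous_convolution_right
    (ContinuousLinearMap.mul ℝ ℝ) hu (hφ.comp continuous_neg)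
  refine h.congr fun x => ?_
  simp [convolution]

lemma locallyIntegrable_of_abs_le {u : Ed d → ℝ} (hu : Measurable u) {K : ℝ}
    (hK : ∀ x, |u x| ≤ K) : LocallyIntegrable u :=
  (locallyIntegrable_const K).mono hu.aestronglyMeasurable
    (ae_of_all _ fun x => (hK x).trans (le_abs_self K))

/-- A locally integrable function whose averages against all translates of any test function
agree is constant almost everywhere. -/
lemma ae_eq_const_of_integral_mul_comp_sub {u : Ed d → ℝ} (hu : LocallyIntegrable u)
    (h : ∀ φ : Ed d → ℝ, ContDiff ℝ (⊤ : ℕ∞) φ → HasCompactSupport φ →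
      ∀ x y, ∫ z, u z * φ (z - x) = ∫ z, u z * φ (z - y)) :
    ∃ c : ℝ, ∀ᵐ x ∂(volume : Measure (Ed d)), u x = c := by
  have hr : ∀ n : ℕ, (0 : ℝ) < 1 / (n + 1) := fun n => Nat.one_div_pos_of_nat
  let φ : ℕ → ContDiffBump (0 : Ed d) := fun n =>
    ⟨1 / (n + 1), 2 * (1 / (n + 1)), hr n, by linarith [hr n]⟩
  have hlim : Tendsto (fun n => (φ n).rOut) atTop (𝓝 0) := by
    have h := (tendsto_one_div_add_atTop_nhds_zero_nat (𝕜 := ℝ)).const_mul 2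
    rwa [mul_zero] at h
  have hae := ContDiffBump.ae_convolution_tendsto_right_of_locallyIntegrable
    (μ := (volume : Measure (Ed d))) hlim (Eventually.of_forall fun n => le_refl _) hu (K := 2)
  have hconv : ∀ n x, convolution ((φ n).normed volume) u (ContinuousLinearMap.lsmul ℝ ℝ)
      volume x = ∫ z, u z * (φ n).normed volume (z - 0) := fun n x => by
    rw [← h _ (φ n).contDiff_normed (φ n).hasCompactSupport_normed x 0, convolution_lsmul_swap]
    refine integral_congr_ae (ae_of_all _ fun z => ?_)
    simp only [smul_eq_mul]
    rw [← neg_sub, ContDiffBump.normed_neg, mul_comm]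
  simp only [hconv] at hae
  obtain ⟨x₀, hx₀⟩ := hae.exists
  exact ⟨u x₀, hae.mono fun x hx => tendsto_nhds_unique hx hx₀⟩

end Liouville

/-- **Liouville property.** If each `X_t` has a bounded continuous density and `u` is a bounded
measurable weak solution of `Au = 0`, then `u` is a.e. constant. -/
theorem statement1 {d : ℕ} (b : Ed d) (Q : Matrix (Fin d) (Fin d) ℝ) (ν : Measure (Ed d))
    (hT : IsLevyTriplet b Q ν)
    (hC1 : ∀ t : ℝ, 0 < t → ∃ p : Ed d → ℝ, Continuous p ∧ (∃ K : ℝ, ∀ x, p x ≤ K) ∧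
      IsTransDensity b Q ν t p)
    (u : Ed d → ℝ) (hu : Measurable u) (hubd : ∃ K : ℝ, ∀ x, |u x| ≤ K)
    (hweak : IsWeakSolZero b Q ν u) :
    ∃ c : ℝ, ∀ᵐ x ∂(volume : Measure (Ed d)), u x = c := by
  obtain ⟨K, hK⟩ := hubd
  obtain ⟨q, hq, hqc⟩ := exists_isDensityFamily hC1
  have hul := locallyIntegrable_of_abs_le hu hK
  refine ae_eq_const_of_integral_mul_comp_sub hul fun φ hφ hc x y => ?_
  have hφi : Integrable φ := hφ.continuous.integrable_of_hasCompactSupport hc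
  refine eq_of_harmonic (v := fun x => ∫ z, u z * φ (z - x)) (M := K * ∫ z, ‖φ z‖) (hqc 1 one_pos)
    (hq.nonneg 1 one_pos) (hq.integral_eq_one 1 one_pos)
    (continuous_integral_mul_comp_sub hul hφ.continuous hc) (fun x => ?_)
    (integral_mul_eq_integral_density_mul hT hq hu hK hweak hφ hc one_pos) x y
  rw [← Real.norm_eq_abs, ← integral_sub_right_eq_self (fun z => ‖φ z‖) x, ← integral_const_mul]
  refine norm_integral_le_of_norm_le ((hφi.comp_sub_right x).norm.const_mul K)
    (ae_of_all _ fun z => ?_)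
  rw [norm_mul]
  exact mul_le_mul_of_nonneg_right (hK z) (norm_nonneg _)
end
end

section
/- Let p : ℝ^d → [0,∞) be a bounded continuous function with ∫_{ℝ^d} p(y) dy = 1. If u : ℝ^d → ℝ is bounded and measurable and u(x) = ∫_{ℝ^d} u(x+y) p(y) dy for Lebesgue-almost every x ∈ ℝ^d, then u is constant Lebesgue-almost everywhere. -/
open MeasureTheory Real Filter Metric
open scoped ENNReal Topology

noncomputable section

theorem integrable_translate_mul {E : Type*} [AddGroup E] [MeasurableSpace E] [MeasurableAdd E]
    {μ : Measure E} {p u : E → ℝ} (hp : Integrable p μ) (hu : Measurable u) {K : ℝ}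
    (hK : ∀ x, |u x| ≤ K) (x : E) : Integrable (fun y => u (x + y) * p y) μ :=
  hp.bdd_mul (hu.comp (measurable_const_add x)).aestronglyMeasurable
    (.of_forall fun y => hK (x + y))

section ChoquetDeny

variable {E : Type*} [NormedAddCommGroup E] [MeasurableSpace E] [BorelSpace E] {μ : Measure E}
  [μ.IsAddHaarMeasure]

/-- Translation is continuous in `L¹` at a continuous nonnegative integrable function. -/
theorem tendsto_integral_abs_sub_translate {p : E → ℝ} (hpc : Continuous p) (hp0 : ∀ x, 0 ≤ p x)
    (hp : Integrable p μ) :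
    Tendsto (fun h => ∫ z, |p z - p (z - h)| ∂μ) (𝓝 0) (𝓝 0) := by
  have hcont : ∀ h, Continuous fun z => max (p z - p (z - h)) 0 := fun h => by fun_prop
  have hbound : ∀ h z, ‖max (p z - p (z - h)) 0‖ ≤ p z := fun h z => by
    rw [Real.norm_of_nonneg (le_max_right _ _)]
    exact max_le (by linarith [hp0 (z - h)]) (hp0 z)
  have hintegrable : ∀ h, Integrable (fun z => max (p z - p (z - h)) 0) μ := fun h =>
    hp.mono' (hcont h).aestronglyMeasurable (.of_forall (hbound h))
  have hpos : Tendsto (fun h => ∫ z, max (p z - p (z - h)) 0 ∂μ) (𝓝 0) (𝓝 (∫ _, (0 : ℝ) ∂μ)) := by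
    refine tendsto_integral_filter_of_dominated_convergence p
      (.of_forall fun h => (hcont h).aestronglyMeasurable)
      (.of_forall fun h => .of_forall (hbound h)) hp (.of_forall fun z => ?_)
    have : Continuous fun h => max (p z - p (z - h)) 0 := by fun_prop
    simpa using this.tendsto 0
  have heq : ∀ h, ∫ z, |p z - p (z - h)| ∂μ = 2 * ∫ z, max (p z - p (z - h)) 0 ∂μ := fun h => by
    have hsub : ∫ z, (p z - p (z - h)) ∂μ = 0 := by
      rw [integral_sub hp (hp.comp_sub_right h), integral_sub_right_eq_self p h, sub_self]
    calc ∫ z, |p z - p (z - h)| ∂μ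
        = ∫ z, (2 * max (p z - p (z - h)) 0 - (p z - p (z - h))) ∂μ := by
          congr 1 with z
          rcases le_total (p z - p (z - h)) 0 with hz | hz
          · rw [abs_of_nonpos hz, max_eq_right hz]; ring
          · rw [abs_of_nonneg hz, max_eq_left hz]; ring
      _ = _ := by
          have hdiff : Integrable (fun z => p z - p (z - h)) μ := hp.sub (hp.comp_sub_right h)
          rw [integral_sub ((hintegrable h).const_mul 2) hdiff, hsub,
            integral_const_mul, sub_zero]
  simp_rw [heq]
  simpa using hpos.const_mul 2

/-- Averaging a bounded measurable function against translates of a continuous density gives a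
uniformly continuous function. -/
theorem uniformContinuous_integral_translate_mul {p : E → ℝ} (hpc : Continuous p)
    (hp0 : ∀ x, 0 ≤ p x) (hp : Integrable p μ) {u : E → ℝ} (hu : Measurable u) {K : ℝ}
    (hK : ∀ x, |u x| ≤ K) : UniformContinuous fun x => ∫ y, u (x + y) * p y ∂μ := by
  have hK0 : 0 ≤ K := (abs_nonneg _).trans (hK 0)
  have hshift : ∀ x h, ∫ y, u (x + h + y) * p y ∂μ = ∫ y, u (x + y) * p (y - h) ∂μ := fun x h => by
    rw [← integral_sub_right_eq_self (fun y => u (x + h + y) * p y) h]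
    congr 1 with y
    congr 2
    abel
  have hle : ∀ x h, |∫ y, u (x + y) * p y ∂μ - ∫ y, u (x + h + y) * p y ∂μ| ≤
      K * ∫ z, |p z - p (z - h)| ∂μ := fun x h => by
    rw [hshift, ← integral_sub (integrable_translate_mul hp hu hK x)
      (integrable_translate_mul (hp.comp_sub_right h) hu hK x), ← integral_const_mul,
      ← Real.norm_eq_abs]
    refine norm_integral_le_of_norm_le
      ((hp.sub (hp.comp_sub_right h)).abs.const_mul K) (.of_forall fun y => ?_)
    rw [← mul_sub, norm_mul]
    exact mul_le_mul_of_nonneg_right (hK _) (abs_nonneg _)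
  have hlim : Tendsto (fun h => K * ∫ z, |p z - p (z - h)| ∂μ) (𝓝 0) (𝓝 0) := by
    simpa using (tendsto_integral_abs_sub_translate hpc hp0 hp).const_mul K
  rw [Metric.uniformContinuous_iff]
  intro ε hε
  obtain ⟨δ, hδ, hball⟩ := Metric.eventually_nhds_iff.1 (hlim.eventually (gt_mem_nhds hε))
  refine ⟨δ, hδ, fun {x y} hxy => ?_⟩
  have h := hle x (y - x)
  rw [add_sub_cancel] at h
  refine h.trans_lt (hball ?_)
  rwa [dist_zero_right, ← dist_eq_norm, dist_comm]

variable [NormedSpace ℝ E] [FiniteDimensional ℝ E]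

/-- A bounded uniformly continuous harmonic function which is almost maximal at `x` is almost
maximal at `x + a`, uniformly in `x`, for every `a` of positive density. -/
theorem exists_forall_sub_le_translate {p : E → ℝ} (hpc : Continuous p) (hp0 : ∀ x, 0 ≤ p x)
    (hp : Integrable p μ) (hpint : ∫ y, p y ∂μ = 1) {g : E → ℝ} (hg : UniformContinuous g) {K : ℝ}
    (hK : ∀ x, |g x| ≤ K) (hharm : ∀ x, g x = ∫ y, g (x + y) * p y ∂μ) {M : ℝ}
    (hM : ∀ x, g x ≤ M) {a : E} (ha : 0 < p a) {δ : ℝ} (hδ : 0 < δ) :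
    ∃ ε > 0, ∀ x, M - ε ≤ g x → M - δ ≤ g (x + a) := by
  obtain ⟨r, hr, hgr⟩ := Metric.uniformContinuous_iff.1 hg (δ / 2) (half_pos hδ)
  obtain ⟨s, hs, hps⟩ := Metric.eventually_nhds_iff.1
    (hpc.continuousAt.eventually (lt_mem_nhds (half_lt_self ha)))
  set t := min r s
  have ht : 0 < t := lt_min hr hs
  have hvol : 0 < μ.real (ball a t) :=
    ENNReal.toReal_pos (measure_ball_pos μ a ht).ne' measure_ball_lt_top.ne
  set c := μ.real (ball a t) * (δ / 2 * (p a / 2))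
  have hc : 0 < c := by positivity
  refine ⟨c / 2, half_pos hc, fun x hx => ?_⟩
  by_contra! hlt
  have hintegrable : Integrable (fun y => (M - g (x + y)) * p y) μ := by
    simp only [sub_mul]
    exact (hp.const_mul M).sub (integrable_translate_mul hp hg.continuous.measurable hK x)
  have heq : ∫ y, (M - g (x + y)) * p y ∂μ = M - g x := by
    simp only [sub_mul]
    rw [integral_sub (hp.const_mul M)
      (integrable_translate_mul hp hg.continuous.measurable hK x), ← hharm, integral_const_mul,
      hpint, mul_one]
  have hge : c ≤ ∫ y, (M - g (x + y)) * p y ∂μ := calc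
    c = ∫ _ in ball a t, δ / 2 * (p a / 2) ∂μ := by rw [setIntegral_const, smul_eq_mul]
    _ ≤ ∫ y in ball a t, (M - g (x + y)) * p y ∂μ := by
      refine setIntegral_mono_on (integrableOn_const measure_ball_lt_top.ne) hintegrable.integrableOn
        measurableSet_ball fun y hy => ?_
      have h1 : dist (x + y) (x + a) < r := by
        rw [dist_add_left]
        exact (mem_ball.1 hy).trans_le (min_le_left _ _)
      have h2 := hps ((mem_ball.1 hy).trans_le (min_le_right _ _))
      have h3 := (abs_lt.1 (Real.dist_eq _ _ ▸ hgr h1)).2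
      exact mul_le_mul (by linarith) h2.le (by positivity) (by linarith [hM (x + y)])
    _ ≤ ∫ y, (M - g (x + y)) * p y ∂μ :=
      setIntegral_le_integral hintegrable
        (.of_forall fun y => mul_nonneg (sub_nonneg.2 (hM _)) (hp0 y))
  linarith

theorem exists_forall_sub_le_nsmul_translate {p : E → ℝ} (hpc : Continuous p)
    (hp0 : ∀ x, 0 ≤ p x) (hp : Integrable p μ) (hpint : ∫ y, p y ∂μ = 1) {g : E → ℝ}
    (hg : UniformContinuous g) {K : ℝ} (hK : ∀ x, |g x| ≤ K)
    (hharm : ∀ x, g x = ∫ y, g (x + y) * p y ∂μ) {M : ℝ} (hM : ∀ x, g x ≤ M) {a : E}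
    (ha : 0 < p a) {δ : ℝ} (hδ : 0 < δ) (n : ℕ) :
    ∃ ε > 0, ∀ x, M - ε ≤ g x → ∀ k < n, M - δ ≤ g (x + k • a) := by
  induction n with
  | zero => exact ⟨1, one_pos, fun _ _ k hk => absurd hk k.not_lt_zero⟩
  | succ n ih =>
    obtain ⟨ε₁, hε₁, h₁⟩ := ih
    obtain ⟨ε₂, hε₂, h₂⟩ :=
      exists_forall_sub_le_translate hpc hp0 hp hpint hg hK hharm hM ha hε₁
    refine ⟨min ε₂ δ, lt_min hε₂ hδ, fun x hx k hk => ?_⟩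
    cases k with
    | zero =>
      rw [zero_smul, add_zero]
      linarith [min_le_right ε₂ δ]
    | succ k =>
      have h := h₁ (x + a) (h₂ x (by linarith [min_le_left ε₂ δ])) k (by omega)
      rwa [add_assoc, ← succ_nsmul'] at h

theorem translate_le_of_harmonic {p : E → ℝ} (hpc : Continuous p) (hp0 : ∀ x, 0 ≤ p x)
    (hp : Integrable p μ) (hpint : ∫ y, p y ∂μ = 1) {f : E → ℝ} (hf : UniformContinuous f) {K : ℝ}
    (hK : ∀ x, |f x| ≤ K) (hharm : ∀ x, f x = ∫ y, f (x + y) * p y ∂μ) {a : E} (ha : 0 < p a)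
    (x : E) : f (x + a) ≤ f x := by
  set g : E → ℝ := fun x => f (x + a) - f x with hgdef
  have hg : UniformContinuous g := (hf.comp (uniformContinuous_id.add_const a)).sub hf
  have hgK : ∀ x, |g x| ≤ K + K := fun x => (abs_sub _ _).trans (add_le_add (hK _) (hK _))
  have hgharm : ∀ x, g x = ∫ y, g (x + y) * p y ∂μ := fun x => by
    have hm := hf.continuous.measurable
    simp only [hgdef, sub_mul]
    rw [hharm (x + a), hharm x]
    simp only [add_right_comm x _ a]
    rw [integral_sub _ (integrable_translate_mul hp hm hK x)]
    simpa only [add_right_comm x a] using integrable_translate_mul hp hm hK (x + a)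
  have hbdd : BddAbove (Set.range g) :=
    ⟨K + K, Set.forall_mem_range.2 fun x => (abs_le.1 (hgK x)).2⟩
  set M := ⨆ x, g x
  have hM : ∀ x, g x ≤ M := le_ciSup hbdd
  suffices M ≤ 0 from sub_nonpos.1 ((hM x).trans this)
  by_contra! hM0
  obtain ⟨n, hn⟩ := exists_nat_gt ((K + K) / (M / 2))
  rw [div_lt_iff₀ (half_pos hM0)] at hn
  obtain ⟨ε, hε, h⟩ := exists_forall_sub_le_nsmul_translate hpc hp0 hp hpint hg hgK hgharm hM ha
    (half_pos hM0) n
  obtain ⟨z, hz⟩ := exists_lt_of_lt_ciSup (sub_lt_self M hε)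
  have hsum : ∑ k ∈ Finset.range n, g (z + k • a) = f (z + n • a) - f z := by
    have := Finset.sum_range_sub (fun k : ℕ => f (z + k • a)) n
    simpa only [hgdef, succ_nsmul, ← add_assoc, zero_smul, add_zero] using this
  have hlow : n * (M / 2) ≤ ∑ k ∈ Finset.range n, g (z + k • a) := by
    rw [← nsmul_eq_mul]
    simpa using Finset.card_nsmul_le_sum (Finset.range n) (fun k => g (z + k • a)) (M / 2)
      fun k hk => by linarith [h z hz.le k (Finset.mem_range.1 hk)]
  linarith [(abs_le.1 (hK (z + n • a))).2, (abs_le.1 (hK z)).1]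

theorem translate_eq_of_harmonic {p : E → ℝ} (hpc : Continuous p) (hp0 : ∀ x, 0 ≤ p x)
    (hp : Integrable p μ) (hpint : ∫ y, p y ∂μ = 1) {f : E → ℝ} (hf : UniformContinuous f) {K : ℝ}
    (hK : ∀ x, |f x| ≤ K) (hharm : ∀ x, f x = ∫ y, f (x + y) * p y ∂μ) {a : E} (ha : 0 < p a)
    (x : E) : f (x + a) = f x := by
  refine (translate_le_of_harmonic hpc hp0 hp hpint hf hK hharm ha x).antisymm ?_
  refine neg_le_neg_iff.1 (translate_le_of_harmonic (f := fun x => -f x) hpc hp0 hp hpint hf.neg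
    (fun x => (abs_neg (f x)).trans_le (hK x)) (fun x => ?_) ha x)
  simp only [neg_mul, integral_neg, ← hharm]

/-- A bounded uniformly continuous function which is harmonic with respect to a continuous
probability density is constant. -/
theorem eq_of_harmonic_s8 {p : E → ℝ} (hpc : Continuous p) (hp0 : ∀ x, 0 ≤ p x)
    (hp : Integrable p μ) (hpint : ∫ y, p y ∂μ = 1) {f : E → ℝ} (hf : UniformContinuous f) {K : ℝ}
    (hK : ∀ x, |f x| ≤ K) (hharm : ∀ x, f x = ∫ y, f (x + y) * p y ∂μ) (x y : E) :
    f x = f y := by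
  obtain ⟨a, ha⟩ : ∃ a, 0 < p a := by
    by_contra! h
    simp [funext fun x => (h x).antisymm (hp0 x)] at hpint
  obtain ⟨r, hr, hpr⟩ := Metric.eventually_nhds_iff.1
    (hpc.continuousAt.eventually (lt_mem_nhds ha))
  have hloc : IsLocallyConstant f := by
    refine (IsLocallyConstant.iff_eventually_eq f).2 fun x =>
      Metric.eventually_nhds_iff.2 ⟨r, hr, fun y hy => ?_⟩
    have h₁ := translate_eq_of_harmonic hpc hp0 hp hpint hf hK hharm ha y
    have h₂ := translate_eq_of_harmonic hpc hp0 hp hpint hf hK hharm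
      (a := a + (y - x)) (hpr (by simpa [dist_eq_norm] using hy)) x
    rw [← h₁, ← h₂]
    congr 1
    abel
  exact hloc.apply_eq_of_preconnectedSpace x y

end ChoquetDeny

/-- **Choquet–Deny type theorem.** If `p` is a bounded continuous probability density and a
bounded measurable `u` satisfies `u(x) = ∫ u(x+y) p(y) dy` a.e., then `u` is a.e. constant. -/
theorem statement8 {d : ℕ} (p : Ed d → ℝ) (hpc : Continuous p) (hp0 : ∀ x, 0 ≤ p x)
    (hpb : ∃ K : ℝ, ∀ x, p x ≤ K) (hpint : (∫ y, p y) = 1)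
    (u : Ed d → ℝ) (hu : Measurable u) (hubd : ∃ K : ℝ, ∀ x, |u x| ≤ K)
    (hconv : ∀ᵐ x ∂(volume : Measure (Ed d)), u x = ∫ y, u (x + y) * p y) :
    ∃ c : ℝ, ∀ᵐ x ∂(volume : Measure (Ed d)), u x = c := by
  obtain ⟨K, hK⟩ := hubd
  have hp : Integrable p := by
    by_contra h
    simp [integral_undef h] at hpint
  set f : Ed d → ℝ := fun x => ∫ y, u (x + y) * p y with hfdef
  have hf : UniformContinuous f := uniformContinuous_integral_translate_mul hpc hp0 hp hu hK
  have hfK : ∀ x, |f x| ≤ K := fun x => by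
    rw [← Real.norm_eq_abs]
    refine (norm_integral_le_of_norm_le (hp.const_mul K) (.of_forall fun y => ?_)).trans_eq
      (by rw [integral_const_mul, hpint, mul_one])
    rw [norm_mul, Real.norm_of_nonneg (hp0 y)]
    exact mul_le_mul_of_nonneg_right (hK _) (hp0 y)
  have hharm : ∀ x, f x = ∫ y, f (x + y) * p y := fun x => by
    refine integral_congr_ae ?_
    filter_upwards [(quasiMeasurePreserving_add_left volume x).ae hconv] with y hy
    rw [hy]
  exact ⟨f 0, hconv.mono fun x hx => hx.trans (eq_of_harmonic_s8 hpc hp0 hp hpint hf hfK hharm x 0)⟩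
end
end

section
/- Let ν be a measure on ℝ with ν({0}) = 0 and ∫ min(1, y²) ν(dy) < ∞, and suppose ∫_{|y| ≥ 1} |y|^n ν(dy) < ∞ for some integer n ≥ 1. Define ψ(ξ) := ∫_{y≠0} (1 − e^{i y ξ} + i y ξ 1_{(0,1)}(|y|)) ν(dy) for ξ ∈ ℝ. Then ψ : ℝ → ℂ is n times continuously differentiable, with ψ'(ξ) = i ∫_{y≠0} y (−e^{i y ξ} + 1_{(0,1)}(|y|)) ν(dy), and ψ^{(k)}(ξ) = −i^k ∫_{y≠0} y^k e^{i y ξ} ν(dy) for all 2 ≤ k ≤ n and ξ ∈ ℝ. -/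
open MeasureTheory Real Filter Metric
open scoped ENNReal Topology

noncomputable section

/-- Indicator function `1_{(0,1)}(|y|)` on `ℝ`. -/
def smallCut1 (y : ℝ) : ℝ := if 0 < |y| ∧ |y| < 1 then 1 else 0

/-- The characteristic exponent of the triplet `(0, 0, ν)` on `ℝ`:
`ψ(ξ) = ∫ (1 - e^{iyξ} + iyξ 1_{(0,1)}(|y|)) ν(dy)`. -/
noncomputable def psi1 (ν : Measure ℝ) (ξ : ℝ) : ℂ :=
  ∫ y, (1 - Complex.exp (Complex.I * (y : ℂ) * (ξ : ℂ))
      + Complex.I * (y : ℂ) * (ξ : ℂ) * (smallCut1 y : ℂ)) ∂ν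

/-- The `k`-th derivative in `ξ` of the integrand of `psi1`. -/
def psiIntegrand : ℕ → ℝ → ℝ → ℂ
  | 0, ξ, y => 1 - Complex.exp (Complex.I * (y : ℂ) * (ξ : ℂ))
      + Complex.I * (y : ℂ) * (ξ : ℂ) * (smallCut1 y : ℂ)
  | 1, ξ, y => Complex.I * ((y : ℂ) * (-Complex.exp (Complex.I * (y : ℂ) * (ξ : ℂ))
      + (smallCut1 y : ℂ)))
  | k + 2, ξ, y => -(Complex.I ^ (k + 2)) *
      ((y : ℂ) ^ (k + 2) * Complex.exp (Complex.I * (y : ℂ) * (ξ : ℂ)))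

/-- The function `y² 1_{|y| < 1} + |y|^n 1_{|y| ≥ 1}`. -/
def momentBound (n : ℕ) (y : ℝ) : ℝ := if 1 ≤ |y| then |y| ^ n else y ^ 2

lemma momentBound_nonneg (n : ℕ) (y : ℝ) : 0 ≤ momentBound n y := by
  unfold momentBound; split_ifs <;> positivity

lemma measurable_smallCut1 : Measurable smallCut1 := by
  unfold smallCut1
  refine Measurable.ite (MeasurableSet.inter ?_ ?_) measurable_const measurable_const
  · exact measurableSet_lt measurable_const measurable_id.abs
  · exact measurableSet_lt measurable_id.abs measurable_const

lemma measurable_psiIntegrand (k : ℕ) (ξ : ℝ) : Measurable (psiIntegrand k ξ) := by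
  have h := measurable_smallCut1
  rcases k with _ | _ | k <;> unfold psiIntegrand <;> fun_prop

lemma integrable_momentBound {ν : Measure ℝ}
    (hν : ∫⁻ y, ENNReal.ofReal (min 1 (y ^ 2)) ∂ν ≠ ⊤) {n : ℕ}
    (hmom : IntegrableOn (fun y => |y| ^ n) {y : ℝ | 1 ≤ |y|} ν) :
    Integrable (momentBound n) ν := by
  have hmeas : MeasurableSet {y : ℝ | 1 ≤ |y|} :=
    measurableSet_le measurable_const measurable_id.abs
  have hmin : Integrable (fun y : ℝ => min 1 (y ^ 2)) ν := by
    refine ⟨by fun_prop, ?_⟩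
    rw [hasFiniteIntegral_iff_ofReal (ae_of_all _ fun y => by positivity)]
    exact hν.lt_top
  refine (hmin.add (hmom.integrable_indicator hmeas)).mono'
    (Measurable.ite hmeas (by fun_prop) (by fun_prop)).aestronglyMeasurable
    (ae_of_all _ fun y => ?_)
  rw [Real.norm_of_nonneg (momentBound_nonneg n y)]
  by_cases hy : 1 ≤ |y|
  · simp only [momentBound, Pi.add_apply, Set.indicator, Set.mem_ofPred_eq, hy, if_true]
    have : 0 ≤ min 1 (y ^ 2) := by positivity
    linarith
  · have : y ^ 2 ≤ 1 := by rw [sq_le_one_iff_abs_le_one]; linarith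
    simp [momentBound, Set.indicator, hy, this]

lemma norm_exp_I_mul_mul (y ξ : ℝ) :
    ‖Complex.exp (Complex.I * (y : ℂ) * (ξ : ℂ))‖ = 1 := by
  rw [mul_assoc, ← Complex.ofReal_mul, Complex.norm_exp_I_mul_ofReal]

lemma hasDerivAt_psiIntegrand (k : ℕ) (ξ y : ℝ) :
    HasDerivAt (fun x => psiIntegrand k x y) (psiIntegrand (k + 1) ξ y) ξ := by
  have hlin : HasDerivAt (fun x : ℝ => Complex.I * (y : ℂ) * (x : ℂ)) (Complex.I * y) ξ := by
    simpa using (Complex.ofRealCLM.hasDerivAt (x := ξ)).const_mul (Complex.I * (y : ℂ))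
  have hexp := hlin.cexp
  rcases k with _ | _ | k
  · refine ((hexp.const_sub 1).add (hlin.mul_const (smallCut1 y : ℂ))).congr_deriv ?_
    simp only [psiIntegrand]; ring
  · refine (((hexp.neg.add_const (smallCut1 y : ℂ)).const_mul (y : ℂ)).const_mul
      Complex.I).congr_deriv ?_
    simp only [psiIntegrand]; ring
  · refine ((hexp.const_mul ((y : ℂ) ^ (k + 2))).const_mul
      (-(Complex.I ^ (k + 2)))).congr_deriv ?_
    simp only [psiIntegrand]; ring

lemma norm_psiIntegrand_one_le {n : ℕ} (hn : 1 ≤ n) (ξ y : ℝ) :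
    ‖psiIntegrand 1 ξ y‖ ≤ (1 + |ξ|) * momentBound n y := by
  simp only [psiIntegrand, norm_mul, Complex.norm_I, one_mul, Complex.norm_real,
    Real.norm_eq_abs]
  by_cases hy : 1 ≤ |y|
  · have hc : smallCut1 y = 0 := if_neg fun h => by linarith [h.2]
    have hp : |y| ≤ |y| ^ n := le_self_pow₀ hy (by omega)
    simp only [momentBound, hy, if_true, hc, Complex.ofReal_zero, add_zero, norm_neg,
      norm_exp_I_mul_mul, mul_one]
    nlinarith [mul_nonneg (abs_nonneg ξ) (pow_nonneg (abs_nonneg y) n)]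
  · rcases eq_or_ne y 0 with rfl | h0
    · rw [abs_zero, zero_mul]
      exact mul_nonneg (by positivity) (momentBound_nonneg n 0)
    have hc : smallCut1 y = 1 := if_pos ⟨abs_pos.2 h0, not_le.1 hy⟩
    have he : ‖-Complex.exp (Complex.I * (y : ℂ) * (ξ : ℂ)) + 1‖ ≤ |y| * |ξ| := by
      rw [neg_add_eq_sub, norm_sub_rev, mul_assoc, ← Complex.ofReal_mul, ← abs_mul]
      exact Real.norm_exp_I_mul_ofReal_sub_one_le
    simp only [momentBound, hy, if_false, hc, Complex.ofReal_one]
    calc |y| * ‖-Complex.exp (Complex.I * (y : ℂ) * (ξ : ℂ)) + 1‖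
        ≤ |y| * (|y| * |ξ|) := by gcongr
      _ = |ξ| * y ^ 2 := by rw [← sq_abs y]; ring
      _ ≤ (1 + |ξ|) * y ^ 2 := by gcongr; linarith

lemma norm_psiIntegrand_le {n : ℕ} (hn : 1 ≤ n) {k : ℕ} (hk : k ≤ n) (ξ y : ℝ) :
    ‖psiIntegrand k ξ y‖ ≤ (1 + |ξ|) ^ 2 * momentBound n y := by
  have hM := momentBound_nonneg n y
  have hξ := abs_nonneg ξ
  rcases k with _ | _ | k
  · have h := (convex_Icc (-|ξ|) |ξ|).norm_image_sub_le_of_norm_hasDerivWithin_le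
      (f := fun x => psiIntegrand 0 x y) (C := (1 + |ξ|) * momentBound n y)
      (fun x _ => (hasDerivAt_psiIntegrand 0 x y).hasDerivWithinAt)
      (fun x hx => (norm_psiIntegrand_one_le hn x y).trans (by
        have : |x| ≤ |ξ| := abs_le.2 hx
        gcongr)) (x := 0) (y := ξ) (by simp) (abs_le.1 le_rfl)
    have h0 : psiIntegrand 0 0 y = 0 := by simp [psiIntegrand]
    simp only [h0, sub_zero, Real.norm_eq_abs] at h
    nlinarith [mul_nonneg (add_nonneg zero_le_one hξ) hM]
  · refine (norm_psiIntegrand_one_le hn ξ y).trans ?_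
    gcongr
    nlinarith
  · simp only [psiIntegrand, norm_mul, norm_neg, norm_pow, Complex.norm_I, one_pow, one_mul,
      norm_exp_I_mul_mul, mul_one, Complex.norm_real, Real.norm_eq_abs]
    have : |y| ^ (k + 2) ≤ momentBound n y := by
      unfold momentBound
      split_ifs with hy
      · exact pow_le_pow_right₀ hy hk
      · rw [← sq_abs y]
        exact pow_le_pow_of_le_one (abs_nonneg y) (not_le.1 hy).le (by omega)
    nlinarith [mul_nonneg hξ hM, mul_nonneg (mul_nonneg hξ hξ) hM]

lemma norm_psiIntegrand_le_of_mem_ball {n : ℕ} (hn : 1 ≤ n) {k : ℕ} (hk : k ≤ n) {ξ x : ℝ}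
    (hx : x ∈ ball ξ 1) (y : ℝ) :
    ‖psiIntegrand k x y‖ ≤ (2 + |ξ|) ^ 2 * momentBound n y := by
  refine (norm_psiIntegrand_le hn hk x y).trans ?_
  have hM := momentBound_nonneg n y
  rw [mem_ball, Real.dist_eq] at hx
  have : 1 + |x| ≤ 2 + |ξ| := by linarith [abs_sub_abs_le_abs_sub x ξ]
  gcongr

lemma integrable_psiIntegrand {ν : Measure ℝ} {n : ℕ} (hn : 1 ≤ n)
    (hM : Integrable (momentBound n) ν) {k : ℕ} (hk : k ≤ n) (ξ : ℝ) :
    Integrable (psiIntegrand k ξ) ν :=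
  (hM.const_mul _).mono' (measurable_psiIntegrand k ξ).aestronglyMeasurable
    (ae_of_all _ (norm_psiIntegrand_le hn hk ξ))

lemma hasDerivAt_integral_psiIntegrand {ν : Measure ℝ} {n : ℕ} (hn : 1 ≤ n)
    (hM : Integrable (momentBound n) ν) {k : ℕ} (hk : k < n) (ξ : ℝ) :
    HasDerivAt (fun x => ∫ y, psiIntegrand k x y ∂ν) (∫ y, psiIntegrand (k + 1) ξ y ∂ν) ξ :=
  (hasDerivAt_integral_of_dominated_loc_of_deriv_le (ball_mem_nhds ξ one_pos)
    (.of_forall fun x => (measurable_psiIntegrand k x).aestronglyMeasurable)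
    (integrable_psiIntegrand hn hM hk.le ξ)
    (measurable_psiIntegrand (k + 1) ξ).aestronglyMeasurable
    (ae_of_all _ fun y _ hx => norm_psiIntegrand_le_of_mem_ball hn hk hx y)
    (hM.const_mul _)
    (ae_of_all _ fun y x _ => hasDerivAt_psiIntegrand k x y)).2

lemma continuous_integral_psiIntegrand {ν : Measure ℝ} {n : ℕ} (hn : 1 ≤ n)
    (hM : Integrable (momentBound n) ν) {k : ℕ} (hk : k ≤ n) :
    Continuous fun x => ∫ y, psiIntegrand k x y ∂ν :=
  continuous_iff_continuousAt.2 fun ξ => continuousAt_of_dominated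
    (.of_forall fun x => (measurable_psiIntegrand k x).aestronglyMeasurable)
    (eventually_of_mem (ball_mem_nhds ξ one_pos) fun _ hx =>
      ae_of_all _ fun y => norm_psiIntegrand_le_of_mem_ball hn hk hx y)
    (hM.const_mul _)
    (ae_of_all _ fun y => (hasDerivAt_psiIntegrand k ξ y).continuousAt)

lemma iteratedDeriv_psi1 {ν : Measure ℝ} {n : ℕ} (hn : 1 ≤ n)
    (hM : Integrable (momentBound n) ν) {k : ℕ} (hk : k ≤ n) :
    iteratedDeriv k (psi1 ν) = fun ξ => ∫ y, psiIntegrand k ξ y ∂ν := by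
  induction k with
  | zero => rw [iteratedDeriv_zero]; rfl
  | succ k ih =>
    rw [iteratedDeriv_succ, ih (by omega)]
    exact funext fun ξ => (hasDerivAt_integral_psiIntegrand hn hM hk ξ).deriv

/-- **Differentiability of the characteristic exponent under moment conditions.** If
`∫_{|y|≥1} |y|^n ν(dy) < ∞`, then `ψ` is `n` times continuously differentiable, with
`ψ'(ξ) = i∫ y(-e^{iyξ} + 1_{(0,1)}(|y|)) ν(dy)` and `ψ^{(k)}(ξ) = -i^k ∫ y^k e^{iyξ} ν(dy)`
for `2 ≤ k ≤ n`. -/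
theorem statement11 (ν : Measure ℝ) (hν0 : ν {0} = 0)
    (hν2 : ∫⁻ y, ENNReal.ofReal (min 1 (y ^ 2)) ∂ν ≠ ⊤)
    (n : ℕ) (hn : 1 ≤ n)
    (hmom : IntegrableOn (fun y => |y| ^ n) {y : ℝ | 1 ≤ |y|} ν) :
    ContDiff ℝ (n : ℕ∞) (psi1 ν) ∧
    (∀ ξ : ℝ, deriv (psi1 ν) ξ
        = Complex.I * ∫ y, (y : ℂ) * (-Complex.exp (Complex.I * (y : ℂ) * (ξ : ℂ))
            + (smallCut1 y : ℂ)) ∂ν) ∧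
    (∀ k : ℕ, 2 ≤ k → k ≤ n → ∀ ξ : ℝ, iteratedDeriv k (psi1 ν) ξ
        = -(Complex.I ^ k) * ∫ y, (y : ℂ) ^ k * Complex.exp (Complex.I * (y : ℂ) * (ξ : ℂ)) ∂ν)
    := by
  have hM := integrable_momentBound hν2 hmom
  refine ⟨contDiff_iff_iteratedDeriv.2 ⟨fun k hk => ?_, fun k hk => ?_⟩, fun ξ => ?_,
    fun k hk2 hk ξ => ?_⟩
  · have hk : k ≤ n := by exact_mod_cast hk
    rw [iteratedDeriv_psi1 hn hM hk]
    exact continuous_integral_psiIntegrand hn hM hk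
  · have hk : k < n := by exact_mod_cast hk
    rw [iteratedDeriv_psi1 hn hM hk.le]
    exact fun ξ => (hasDerivAt_integral_psiIntegrand hn hM hk ξ).differentiableAt
  · rw [← iteratedDeriv_one, iteratedDeriv_psi1 hn hM hn, ← integral_const_mul]
    rfl
  · obtain ⟨k, rfl⟩ := Nat.exists_eq_add_of_le' hk2
    rw [iteratedDeriv_psi1 hn hM hk, ← integral_const_mul]
    rfl
end
end

section
/- Let ν be a measure on ℝ with ν({0}) = 0 and ∫ min(1, y²) ν(dy) < ∞, let k ≥ 1 be an integer with ∫_{|y| ≥ 1} |y|^k ν(dy) < ∞, and let 0 ≤ β ≤ k. For φ ∈ C_c^∞(ℝ) define A_1 φ(x) := i ∫_{y≠0} y (−φ(x+y) + φ(x) 1_{(0,1)}(|y|)) ν(dy) and, for k ≥ 2, A_k φ(x) := −i^k ∫_{y≠0} y^k φ(x+y) ν(dy). Then for every R ≥ 1 and every φ ∈ C_c^∞(ℝ) with supp φ ⊆ [−R, R]: ∫_{|x| ≥ 2R} |x|^{β−k} |A_k φ(x)| dx ≤ 2^{k−β} ‖φ‖_{L¹(dx)} ∫_{|y| ≥ 1}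 |y|^β ν(dy). -/
open MeasureTheory Real Filter Metric
open scoped ENNReal Topology

noncomputable section

/-- The operators `A_k`: `A_1 φ(x) = i ∫ y(-φ(x+y) + φ(x)1_{(0,1)}(|y|)) ν(dy)` and
`A_k φ(x) = -i^k ∫ y^k φ(x+y) ν(dy)` for `k ≥ 2`. -/
noncomputable def opAk (ν : Measure ℝ) (k : ℕ) (φ : ℝ → ℝ) (x : ℝ) : ℂ :=
  if k = 1 then
    Complex.I * ∫ y, (y : ℂ) * (-(φ (x + y) : ℂ) + (φ x : ℂ) * (smallCut1 y : ℂ)) ∂ν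
  else
    -(Complex.I ^ k) * ∫ y, (y : ℂ) ^ k * (φ (x + y) : ℂ) ∂ν

/-- At a zero `x` of `φ`, `A_k φ(x)` is controlled by the `k`-th absolute moment of `φ(x + ·)`. -/
theorem enorm_opAk_le (ν : Measure ℝ) (k : ℕ) {φ : ℝ → ℝ} {x : ℝ} (hx : φ x = 0) :
    ‖opAk ν k φ x‖ₑ ≤ ∫⁻ y, ENNReal.ofReal (|y| ^ k * |φ (x + y)|) ∂ν := by
  unfold opAk
  split_ifs with hk
  · subst hk
    rw [enorm_mul, ← ofReal_norm Complex.I]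
    simp only [Complex.norm_I, ENNReal.ofReal_one, one_mul]
    refine (enorm_integral_le_lintegral_enorm _).trans (lintegral_mono fun y => ?_)
    rw [← ofReal_norm]
    simp [hx]
  · rw [enorm_mul, ← ofReal_norm (-(Complex.I ^ k))]
    simp only [norm_neg, norm_pow, Complex.norm_I, one_pow, ENNReal.ofReal_one, one_mul]
    refine (enorm_integral_le_lintegral_enorm _).trans (lintegral_mono fun y => ?_)
    rw [← ofReal_norm]
    simp

/-- If `φ` vanishes outside `[-R, R]` and `|x| ≥ 2R`, then on the support of `φ(x + ·)` one has
`|y| ≥ 1` and the weight `|x|^{β-k}` turns `|y|^k` into `2^{k-β} |y|^β`. -/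
theorem rpow_mul_pow_mul_le_indicator {k : ℕ} {β R x : ℝ} (hβk : β ≤ k) (hR : 1 ≤ R)
    {φ : ℝ → ℝ} (hφ : ∀ z, φ z ≠ 0 → |z| ≤ R) (hx : 2 * R ≤ |x|) (y : ℝ) :
    ENNReal.ofReal (|x| ^ (β - (k : ℝ))) * ENNReal.ofReal (|y| ^ k * |φ (x + y)|) ≤
      {y : ℝ | 1 ≤ |y|}.indicator
        (fun y => ENNReal.ofReal ((2 : ℝ) ^ ((k : ℝ) - β) * |y| ^ β * |φ (x + y)|)) y := by
  by_cases h0 : φ (x + y) = 0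
  · simp [h0]
  have hxy := hφ _ h0
  have h1 : |x| ≤ |x + y| + |y| := by simpa using abs_sub (x + y) y
  have h2 : |y| ≤ |x + y| + |x| := by simpa using abs_sub (x + y) x
  have hy : 1 ≤ |y| := by linarith
  have hxpos : 0 < |x| := by linarith
  have hypos : 0 < |y| := by linarith
  rw [Set.indicator_of_mem (by exact hy), ← ENNReal.ofReal_mul (by positivity), ← mul_assoc]
  refine ENNReal.ofReal_le_ofReal (mul_le_mul_of_nonneg_right ?_ (abs_nonneg _))
  have hle : |y| ^ ((k : ℝ) - β) ≤ (2 * |x|) ^ ((k : ℝ) - β) :=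
    rpow_le_rpow hypos.le (by linarith) (by linarith)
  have hyk : |y| ^ k = |y| ^ β * |y| ^ ((k : ℝ) - β) := by
    rw [← rpow_add hypos, add_sub_cancel, rpow_natCast]
  have hinv : |x| ^ (β - (k : ℝ)) * |x| ^ ((k : ℝ) - β) = 1 := by
    rw [← rpow_add hxpos]; simp
  rw [mul_rpow zero_le_two hxpos.le] at hle
  calc |x| ^ (β - (k : ℝ)) * |y| ^ k
      = |x| ^ (β - (k : ℝ)) * |y| ^ β * |y| ^ ((k : ℝ) - β) := by rw [hyk]; ring
    _ ≤ |x| ^ (β - (k : ℝ)) * |y| ^ β * (2 ^ ((k : ℝ) - β) * |x| ^ ((k : ℝ) - β)) := by gcongr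
    _ = (|x| ^ (β - (k : ℝ)) * |x| ^ ((k : ℝ) - β)) * (2 ^ ((k : ℝ) - β) * |y| ^ β) := by ring
    _ = 2 ^ ((k : ℝ) - β) * |y| ^ β := by rw [hinv, one_mul]

theorem measurableSet_one_le_abs : MeasurableSet {y : ℝ | 1 ≤ |y|} :=
  measurableSet_le measurable_const measurable_norm

/-- A Lévy measure is finite away from the origin. -/
theorem measure_one_le_abs_lt_top {ν : Measure ℝ}
    (hν : ∫⁻ y, ENNReal.ofReal (min 1 (y ^ 2)) ∂ν ≠ ⊤) : ν {y : ℝ | 1 ≤ |y|} < ⊤ := by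
  refine lt_of_le_of_lt ?_ hν.lt_top
  rw [← lintegral_indicator_one measurableSet_one_le_abs]
  refine lintegral_mono (Set.indicator_le fun y hy => ?_)
  have hy' : 1 ≤ y ^ 2 := (one_le_sq_iff_one_le_abs y).2 hy
  simp [min_eq_left hy']

/-- Tonelli's theorem for a separated kernel, with translation invariance in the first variable. -/
theorem lintegral_lintegral_mul_comp_add (μ : Measure ℝ) [SFinite μ] {f g : ℝ → ℝ≥0∞}
    (hf : Measurable f) (hg : Measurable g) :
    ∫⁻ x, ∫⁻ y, g y * f (x + y) ∂μ = (∫⁻ y, g y ∂μ) * ∫⁻ x, f x := by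
  rw [lintegral_lintegral_swap (by fun_prop)]
  rw [← lintegral_mul_const _ hg]
  refine lintegral_congr fun y => ?_
  rw [lintegral_const_mul _ (by fun_prop), lintegral_add_right_eq_self f y]

/-- **Weighted integral estimate for `A_k φ` outside a ball.** For every `R ≥ 1` and every test
function `φ` supported in `[-R, R]`:
`∫_{|x| ≥ 2R} |x|^{β-k} |A_k φ(x)| dx ≤ 2^{k-β} ‖φ‖_{L¹} ∫_{|y| ≥ 1} |y|^β ν(dy)`. -/
theorem statement12 (ν : Measure ℝ) (hν0 : ν {0} = 0)
    (hν2 : ∫⁻ y, ENNReal.ofReal (min 1 (y ^ 2)) ∂ν ≠ ⊤)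
    (k : ℕ) (hk : 1 ≤ k)
    (hmom : IntegrableOn (fun y => |y| ^ k) {y : ℝ | 1 ≤ |y|} ν)
    (β : ℝ) (hβ0 : 0 ≤ β) (hβk : β ≤ k) :
    ∀ R : ℝ, 1 ≤ R → ∀ φ : ℝ → ℝ, ContDiff ℝ (⊤ : ℕ∞) φ → HasCompactSupport φ →
      tsupport φ ⊆ Set.Icc (-R) R →
      ∫⁻ x in {x : ℝ | 2 * R ≤ |x|}, ENNReal.ofReal (|x| ^ (β - (k : ℝ)) * ‖opAk ν k φ x‖)
        ≤ ENNReal.ofReal ((2 : ℝ) ^ ((k : ℝ) - β) * (∫ x, |φ x|)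
            * ∫ y in {y : ℝ | 1 ≤ |y|}, |y| ^ β ∂ν) := by
  intro R hR φ hφ hcs hsupp
  set S : Set ℝ := {y : ℝ | 1 ≤ |y|}
  have hφR : ∀ z, φ z ≠ 0 → |z| ≤ R := fun z hz =>
    abs_le.2 (hsupp (subset_tsupport _ hz))
  have hS : MeasurableSet S := measurableSet_one_le_abs
  have : IsFiniteMeasure (ν.restrict S) :=
    isFiniteMeasure_restrict.2 (measure_one_le_abs_lt_top hν2).ne
  have hβint : IntegrableOn (fun y => |y| ^ β) S ν := by
    refine Integrable.mono' hmom (by fun_prop) ?_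
    filter_upwards [ae_restrict_mem hS] with y hy
    rw [norm_of_nonneg (by positivity), ← rpow_natCast]
    exact rpow_le_rpow_of_exponent_le hy hβk
  have hφint : Integrable (fun x => |φ x|) := (hφ.continuous.integrable_of_hasCompactSupport hcs).abs
  have hφm : Measurable φ := hφ.continuous.measurable
  have hpt : ∀ x ∈ {x : ℝ | 2 * R ≤ |x|},
      ENNReal.ofReal (|x| ^ (β - (k : ℝ)) * ‖opAk ν k φ x‖) ≤
        ∫⁻ y in S, ENNReal.ofReal ((2 : ℝ) ^ ((k : ℝ) - β) * |y| ^ β) *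
          ENNReal.ofReal |φ (x + y)| ∂ν := by
    intro x hx
    have hx' : 2 * R ≤ |x| := hx
    have hx0 : φ x = 0 := by
      by_contra h
      linarith [hφR x h]
    rw [ENNReal.ofReal_mul (by positivity), ofReal_norm]
    calc ENNReal.ofReal (|x| ^ (β - (k : ℝ))) * ‖opAk ν k φ x‖ₑ
        ≤ ENNReal.ofReal (|x| ^ (β - (k : ℝ))) *
            ∫⁻ y, ENNReal.ofReal (|y| ^ k * |φ (x + y)|) ∂ν := by
          gcongr
          exact enorm_opAk_le ν k hx0
      _ = ∫⁻ y, ENNReal.ofReal (|x| ^ (β - (k : ℝ))) *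
            ENNReal.ofReal (|y| ^ k * |φ (x + y)|) ∂ν :=
          (lintegral_const_mul' _ _ ENNReal.ofReal_ne_top).symm
      _ ≤ _ := lintegral_mono (rpow_mul_pow_mul_le_indicator hβk hR hφR hx')
      _ = _ := by
          rw [lintegral_indicator hS]
          exact lintegral_congr fun y => ENNReal.ofReal_mul (by positivity)
  calc ∫⁻ x in {x : ℝ | 2 * R ≤ |x|}, ENNReal.ofReal (|x| ^ (β - (k : ℝ)) * ‖opAk ν k φ x‖)
      ≤ ∫⁻ x in {x : ℝ | 2 * R ≤ |x|}, ∫⁻ y in S,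
          ENNReal.ofReal ((2 : ℝ) ^ ((k : ℝ) - β) * |y| ^ β) * ENNReal.ofReal |φ (x + y)| ∂ν :=
        setLIntegral_mono' (measurableSet_le measurable_const measurable_norm) hpt
    _ ≤ ∫⁻ x, ∫⁻ y in S,
          ENNReal.ofReal ((2 : ℝ) ^ ((k : ℝ) - β) * |y| ^ β) * ENNReal.ofReal |φ (x + y)| ∂ν :=
        setLIntegral_le_lintegral _ _
    _ = (∫⁻ y in S, ENNReal.ofReal ((2 : ℝ) ^ ((k : ℝ) - β) * |y| ^ β) ∂ν) *
          ∫⁻ x, ENNReal.ofReal |φ x| :=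
        lintegral_lintegral_mul_comp_add (ν.restrict S) (f := fun x => ENNReal.ofReal |φ x|)
          (by fun_prop) (by fun_prop)
    _ = _ := by
        rw [← ofReal_integral_eq_lintegral_ofReal (hβint.const_mul _)
            (ae_of_all _ fun y => by positivity),
          ← ofReal_integral_eq_lintegral_ofReal hφint (ae_of_all _ fun x => abs_nonneg _),
          ← ENNReal.ofReal_mul (by positivity), integral_const_mul]
        congr 1
        ring
end
end

section
/- Let u : ℝ^d → ℝ be continuous and let m ≥ 1 be an integer. Define the difference operators Δ_h u(x) := u(x+h) − u(x) and Δ_h^j u := Δ_h(Δ_h^{j−1} u) for j ≥ 2. If Δ_h^m u(x) = 0 for all x ∈ ℝ^d and all h ∈ ℝ^d with |h| ≤ 1, then u is a polynomial function of total degree at most d(m−1). -/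
open MeasureTheory Real Filter Metric
open scoped ENNReal Topology

noncomputable section

/-- The forward difference operator `Δ_h u(x) = u(x+h) - u(x)`. -/
def fdiff {d : ℕ} (h : Ed d) (u : Ed d → ℝ) : Ed d → ℝ := fun x => u (x + h) - u x

/-- Along an arithmetic progression, a function whose `m`-th forward difference vanishes agrees
with a polynomial of degree less than `m`. -/
theorem exists_polynomial_of_fwdDiff_iter_eq_zero {K M : Type*} [Field K] [CharZero K]
    [AddCommGroup M] {f : M → K} {m : ℕ} (hm : 1 ≤ m) {h : M}
    (hf : ∀ x, (fwdDiff h)^[m] f x = 0) (y : M) :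
    ∃ q : Polynomial K, q.natDegree < m ∧ ∀ n : ℕ, f (y + n • h) = q.eval (n : K) := by
  have hzero : ∀ k, m ≤ k → (fwdDiff h)^[k] f y = 0 := by
    intro k hk
    obtain ⟨j, rfl⟩ := Nat.exists_eq_add_of_le' hk
    rw [Function.iterate_add_apply, show (fwdDiff h)^[m] f = fun _ => 0 from funext hf]
    have hfix : fwdDiff h (fun _ : M => (0 : K)) = fun _ => 0 := fwdDiff_const h 0
    rw [Function.iterate_fixed hfix]
  refine ⟨∑ k ∈ Finset.range m,
    Polynomial.C ((fwdDiff h)^[k] f y / (k.factorial : K)) * descPochhammer K k, ?_, fun n => ?_⟩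
  · refine Nat.lt_of_le_pred hm (Polynomial.natDegree_sum_le_of_forall_le _ _ fun k hk => ?_)
    refine (Polynomial.natDegree_C_mul_le _ _).trans ?_
    rw [descPochhammer_natDegree]
    exact Nat.le_pred_of_lt (Finset.mem_range.mp hk)
  · have hterm : ∀ k, (n.choose k : K) * (fwdDiff h)^[k] f y =
        (Polynomial.C ((fwdDiff h)^[k] f y / (k.factorial : K)) * descPochhammer K k).eval
          (n : K) := by
      intro k
      have hk : (k.factorial : K) ≠ 0 := Nat.cast_ne_zero.mpr k.factorial_ne_zero
      rw [Polynomial.eval_mul, Polynomial.eval_C, descPochhammer_eval_eq_descFactorial,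
        Nat.descFactorial_eq_factorial_mul_choose, Nat.cast_mul]
      field_simp
    rw [shift_eq_sum_fwdDiff_iter h f n y, Polynomial.eval_finsetSum]
    simp_rw [← hterm, nsmul_eq_mul]
    rcases le_total (n + 1) m with hnm | hnm
    · refine Finset.sum_subset (Finset.range_mono hnm) fun k _ hk => ?_
      rw [Nat.choose_eq_zero_of_lt (by simpa using hk), Nat.cast_zero, zero_mul]
    · refine (Finset.sum_subset (Finset.range_mono hnm) fun k _ hk => ?_).symm
      rw [hzero k (by simpa using hk), mul_zero]

/-- A continuous function on `ℝ` whose `m`-th forward differences with small increments vanish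
is a polynomial function of degree less than `m`. -/
theorem exists_polynomial_of_continuous_of_fwdDiff_iter_eq_zero {f : ℝ → ℝ} (hf : Continuous f)
    {m : ℕ} (hm : 1 ≤ m) (hdiff : ∀ h : ℝ, |h| ≤ 1 → ∀ x, (fwdDiff h)^[m] f x = 0) :
    ∃ p : Polynomial ℝ, p.natDegree < m ∧ ∀ t, f t = p.eval t := by
  obtain ⟨p, hp, hfp⟩ :=
    exists_polynomial_of_fwdDiff_iter_eq_zero hm (hdiff 1 (by simp)) 0
  replace hfp : ∀ n : ℕ, f n = p.eval (n : ℝ) := fun n => by simpa using hfp n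
  have hgrid : ∀ M N k : ℕ, 1 ≤ N →
      f (-M + k * (N : ℝ)⁻¹) = p.eval (-M + k * (N : ℝ)⁻¹) := by
    intro M N k hN
    have hN0 : (N : ℝ) ≠ 0 := by positivity
    have hN1 : |(N : ℝ)⁻¹| ≤ 1 := by
      rw [abs_of_nonneg (by positivity)]
      exact inv_le_one_of_one_le₀ (by exact_mod_cast hN)
    obtain ⟨q, hq, hfq⟩ :=
      exists_polynomial_of_fwdDiff_iter_eq_zero hm (hdiff _ hN1) (-M : ℝ)
    simp only [nsmul_eq_mul] at hfq
    let r : Polynomial ℝ := p.comp (Polynomial.C (N : ℝ)⁻¹ * Polynomial.X + Polynomial.C (-M : ℝ))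
    have hr : r.natDegree < m := by
      refine lt_of_le_of_lt Polynomial.natDegree_comp_le ?_
      exact lt_of_le_of_lt (mul_le_of_le_one_right (Nat.zero_le _) Polynomial.natDegree_linear_le) hp
    have hreval : ∀ t : ℝ, r.eval t = p.eval (-M + t * (N : ℝ)⁻¹) := by
      intro t
      simp only [r, Polynomial.eval_comp, Polynomial.eval_add, Polynomial.eval_mul,
        Polynomial.eval_C, Polynomial.eval_X]
      congr 1
      ring
    have hqr : q = r := by
      refine Polynomial.eq_of_degrees_lt_of_eval_index_eq (Finset.range m)
        (v := fun i : ℕ => (((M + i) * N : ℕ) : ℝ)) ?_ ?_ ?_ ?_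
      · intro i _ j _ hij
        have hij' : (M + i) * N = (M + j) * N := Nat.cast_injective (R := ℝ) hij
        have := Nat.eq_of_mul_eq_mul_right hN hij'
        omega
      · rw [Finset.card_range]
        exact Polynomial.degree_le_natDegree.trans_lt (by exact_mod_cast hq)
      · rw [Finset.card_range]
        exact Polynomial.degree_le_natDegree.trans_lt (by exact_mod_cast hr)
      · intro i _
        have hi : (-M + (((M + i) * N : ℕ) : ℝ) * (N : ℝ)⁻¹ : ℝ) = i := by
          push_cast
          field_simp
          ring
        rw [hreval, ← hfq, hi, hfp]
    rw [hfq, hqr, hreval]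
  refine ⟨p, hp, congr_fun (Rat.isDenseEmbedding_coe_real.dense.equalizer hf p.continuous ?_)⟩
  funext r
  obtain ⟨k, hk⟩ : ∃ k : ℕ, (k : ℤ) = r.num + r.num.natAbs * r.den :=
    ⟨(r.num + r.num.natAbs * r.den).toNat, Int.toNat_of_nonneg (by
      have : |r.num| ≤ |r.num| * (r.den : ℤ) :=
        le_mul_of_one_le_right (abs_nonneg _) (by exact_mod_cast r.den_pos)
      have := neg_abs_le r.num
      rw [Int.natCast_natAbs]
      omega)⟩
  have hden : (r.den : ℝ) ≠ 0 := by exact_mod_cast r.den_nz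
  have hr : (r : ℝ) = -(r.num.natAbs : ℕ) + k * (r.den : ℝ)⁻¹ := by
    have hk' : (k : ℝ) = r.num + (r.num.natAbs : ℕ) * r.den := by
      rw [← Int.cast_natCast k, hk]
      simp
    rw [hk', Rat.cast_def]
    field_simp
    ring
  simp only [Function.comp_apply]
  rw [hr]
  exact hgrid _ _ _ r.den_pos

/-- A function which is a polynomial of degree less than `m` in each variable separately is a
polynomial of total degree at most `d * (m - 1)`. -/
theorem exists_mvPolynomial_of_separately_polynomial {K : Type*} [Field K] [CharZero K] {m : ℕ}
    {d : ℕ} (v : (Fin d → K) → K)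
    (hv : ∀ x i, ∃ p : Polynomial K, p.natDegree < m ∧
      ∀ t, v (Function.update x i t) = p.eval t) :
    ∃ P : MvPolynomial (Fin d) K, P.totalDegree ≤ d * (m - 1) ∧
      ∀ x, v x = MvPolynomial.eval x P := by
  induction d with
  | zero =>
    refine ⟨MvPolynomial.C (v 0), by simp, fun x => ?_⟩
    rw [MvPolynomial.eval_C, Subsingleton.elim x 0]
  | succ d ih =>
    have hslice : ∀ a : K, ∃ P : MvPolynomial (Fin d) K, P.totalDegree ≤ d * (m - 1) ∧
        ∀ y, v (Fin.cons a y) = MvPolynomial.eval y P := by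
      intro a
      refine ih (fun y => v (Fin.cons a y)) fun y i => ?_
      obtain ⟨p, hp, hvp⟩ := hv (Fin.cons a y) i.succ
      exact ⟨p, hp, fun t => by rw [Fin.cons_update, hvp]⟩
    choose P hP hvP using hslice
    have hinj : Set.InjOn (fun a : ℕ => (a : K)) (Finset.range m) := Nat.cast_injective.injOn
    let L : ℕ → Polynomial K := Lagrange.basis (Finset.range m) fun a : ℕ => (a : K)
    refine ⟨∑ a ∈ Finset.range m, MvPolynomial.rename Fin.succ (P a) *
      (L a).toMvPolynomial 0, ?_, fun x => ?_⟩
    · refine MvPolynomial.totalDegree_finsetSum_le fun a ha => ?_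
      refine (MvPolynomial.totalDegree_mul _ _).trans ?_
      rw [Nat.succ_mul]
      refine add_le_add ((MvPolynomial.totalDegree_rename_le _ _).trans (hP a)) ?_
      have hL : (L a).natDegree = m - 1 := by
        simpa using Lagrange.natDegree_basis hinj ha
      rw [← hL, Polynomial.toMvPolynomial, Polynomial.aeval_eq_sum_range]
      refine MvPolynomial.totalDegree_finsetSum_le fun k hk => ?_
      refine (MvPolynomial.totalDegree_smul_le _ _).trans ?_
      rw [MvPolynomial.totalDegree_X_pow]
      exact Nat.lt_succ_iff.mp (Finset.mem_range.mp hk)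
    · obtain ⟨p, hp, hvp⟩ := hv x 0
      have hcons : ∀ t, p.eval t = v (Fin.cons t (Fin.tail x)) := by
        intro t
        rw [← hvp, ← Fin.update_cons_zero (x 0) (Fin.tail x), Fin.cons_self_tail]
      have hinterp : p = Lagrange.interpolate (Finset.range m) (fun a : ℕ => (a : K))
          fun a => p.eval (a : K) := by
        refine Lagrange.eq_interpolate hinj ?_
        rw [Finset.card_range]
        exact Polynomial.degree_le_natDegree.trans_lt (by exact_mod_cast hp)
      calc v x = p.eval (x 0) := by rw [hcons, Fin.cons_self_tail]
        _ = _ := by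
          rw [hinterp, Lagrange.interpolate_apply, Polynomial.eval_finsetSum, map_sum]
          refine Finset.sum_congr rfl fun a _ => ?_
          rw [Polynomial.eval_mul, Polynomial.eval_C, map_mul, MvPolynomial.eval_rename,
            MvPolynomial.eval_toMvPolynomial, hcons, hvP]
          rfl

/-- Iterated differences of the restriction of `u` to a line. -/
theorem fwdDiff_iter_comp_add_smul {d : ℕ} (u : Ed d → ℝ) (x e : Ed d) (h : ℝ) (m : ℕ) (t : ℝ) :
    (fwdDiff h)^[m] (fun s => u (x + s • e)) t = (fdiff (h • e))^[m] u (x + t • e) := by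
  induction m generalizing u with
  | zero => rfl
  | succ m ih =>
    rw [Function.iterate_succ_apply, Function.iterate_succ_apply, ← ih]
    refine congr_fun (congr_arg _ (funext fun s => ?_)) t
    simp only [fwdDiff, fdiff, add_smul, add_assoc]

/-- **Vanishing iterated differences characterize polynomials.** If `u` is continuous and
`Δ_h^m u = 0` for all `|h| ≤ 1`, then `u` is a polynomial function of total degree at most
`d(m-1)`. -/
theorem statement15 {d : ℕ} (u : Ed d → ℝ) (hu : Continuous u) (m : ℕ) (hm : 1 ≤ m)
    (hdiff : ∀ h : Ed d, ‖h‖ ≤ 1 → ∀ x, (fdiff h)^[m] u x = 0) :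
    ∃ P : MvPolynomial (Fin d) ℝ, P.totalDegree ≤ d * (m - 1) ∧
      ∀ x : Ed d, u x = MvPolynomial.eval (fun i => x i) P := by
  obtain ⟨P, hP, huP⟩ := exists_mvPolynomial_of_separately_polynomial (m := m)
    (fun x : Fin d → ℝ => u (WithLp.toLp 2 x)) fun x i => by
      let e : Ed d := EuclideanSpace.single i 1
      let x₀ : Ed d := WithLp.toLp 2 (Function.update x i 0)
      have hupdate : ∀ t : ℝ, WithLp.toLp 2 (Function.update x i t) = x₀ + t • e := by
        intro t
        ext j
        rcases eq_or_ne j i with rfl | hj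
        · simp [x₀, e]
        · simp [x₀, e, hj]
      simp_rw [hupdate]
      refine exists_polynomial_of_continuous_of_fwdDiff_iter_eq_zero
        (f := fun t => u (x₀ + t • e)) (by fun_prop) hm fun h hh t => ?_
      rw [fwdDiff_iter_comp_add_smul]
      exact hdiff _ (by simpa [e, norm_smul] using hh) _
  exact ⟨P, hP, fun x => huP x.ofLp⟩
end
end
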